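/- For every n ∈ ℕ there exists a constant K_n > 0 such that every compact n-manifold M with boundary satisfies ‖M‖ ≤ K_n · ‖M‖_I. In particular, ‖M‖_I = 0 if and only if ‖M‖ = 0. -/

import Mathlib

open scoped BigOperators
open Topology
noncomputable section

/-! ### Quasicones and marked spaces -/

/-- `B` is a *quasicone* with apex `b`: there is a homotopy `H` from the identity to the
constant map at `b` with `H ⁻¹' {b} = ({b} × I) ∪ (B × {1})`. -/
def IsQuasicone {B : Type*} [TopologicalSpace B] (b : B) : Prop :=
  ∃ H : C(B × unitInterval, B),
    (∀ x, H (x, 0) = x) ∧ (∀ x, H (x, 1) = b) ∧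
    (∀ x t, H (x, t) = b ↔ x = b ∨ t = 1)

/-- A *marked space* `(X, B)`: `B` is closed in `X` and every `b ∈ B` has a closed
quasiconical neighbourhood `F b` with apex `b`, the `F b` being pairwise disjoint. -/
structure IsMarkedSpace (X : Type*) [TopologicalSpace X] (B : Set X) : Prop where
  closed : IsClosed B
  quasicones : ∃ F : B → Set X,
    (∀ b : B, IsClosed (F b)) ∧ (∀ b : B, F b ∈ nhds (b : X)) ∧
    (∀ b b' : B, b ≠ b' → Disjoint (F b) (F b')) ∧
    (∀ b : B, ∃ hb : (b : X) ∈ F b, IsQuasicone (⟨(b : X), hb⟩ : F b))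

/-! ### Singular chains -/

/-- The topological standard `n`-simplex. -/
abbrev TopSimplex (n : ℕ) : Type := ↥(stdSimplex ℝ (Fin (n + 1)))

/-- Singular `n`-simplices in `X`. -/
abbrev SingularSimplex (X : Type*) [TopologicalSpace X] (n : ℕ) := C(TopSimplex n, X)

/-- Singular `n`-chains in `X` with coefficients in `R`. -/
abbrev SingularChain (R : Type*) [Ring R] (X : Type*) [TopologicalSpace X] (n : ℕ) :=
  SingularSimplex X n →₀ R

/-- The `i`-th coface map, on barycentric coordinates. -/
def cofaceFun {n : ℕ} (i : Fin (n + 2)) (x : Fin (n + 1) → ℝ) : Fin (n + 2) → ℝ :=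
  fun j => ∑ k : Fin (n + 1), if i.succAbove k = j then x k else 0

lemma cofaceFun_mem {n : ℕ} (i : Fin (n + 2)) {x : Fin (n + 1) → ℝ}
    (hx : x ∈ stdSimplex ℝ (Fin (n + 1))) : cofaceFun i x ∈ stdSimplex ℝ (Fin (n + 2)) := by
  constructor
  · intro j
    refine Finset.sum_nonneg fun k _ => ?_
    split_ifs
    · exact hx.1 k
    · exact le_rfl
  · unfold cofaceFun
    rw [Finset.sum_comm]
    simp only [Finset.sum_ite_eq, Finset.mem_univ, if_true]
    exact hx.2

/-- The `i`-th face inclusion `Δⁿ → Δⁿ⁺¹`. -/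
def coface {n : ℕ} (i : Fin (n + 2)) : C(TopSimplex n, TopSimplex (n + 1)) where
  toFun x := ⟨cofaceFun i (x : Fin (n + 1) → ℝ), cofaceFun_mem i x.2⟩
  continuous_toFun := by
    refine Continuous.subtype_mk ?_ _
    refine continuous_pi fun j => ?_
    unfold cofaceFun
    refine continuous_finset_sum _ fun k _ => ?_
    by_cases h : i.succAbove k = j
    · simp only [if_pos h]
      exact (continuous_apply k).comp continuous_subtype_val
    · simp only [if_neg h]
      exact continuous_const

/-- The boundary of a single `(n+1)`-simplex. -/
def boundaryOf (R : Type*) [Ring R] {X : Type*} [TopologicalSpace X] {n : ℕ}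
    (σ : SingularSimplex X (n + 1)) : SingularChain R X n :=
  ∑ i : Fin (n + 2), Finsupp.single (σ.comp (coface i)) ((-1 : R) ^ (i : ℕ))

/-- The singular boundary operator. -/
def boundary (R : Type*) [Ring R] (X : Type*) [TopologicalSpace X] (n : ℕ) :
    SingularChain R X (n + 1) →ₗ[R] SingularChain R X n :=
  Finsupp.lsum ℕ fun σ => LinearMap.toSpanSingleton R _ (boundaryOf R σ)

/-- Push-forward of chains along a continuous map. -/
def pushChain (R : Type*) [Ring R] {X Y : Type*} [TopologicalSpace X] [TopologicalSpace Y]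
    (f : C(X, Y)) (n : ℕ) : SingularChain R X n →ₗ[R] SingularChain R Y n :=
  Finsupp.lmapDomain R R fun σ : SingularSimplex X n => f.comp σ

/-- The face of `Δⁿ` spanned by the vertices in `S`. -/
def faceSet (n : ℕ) (S : Finset (Fin (n + 1))) : Set (TopSimplex n) :=
  {x | ∀ j ∉ S, (x : Fin (n + 1) → ℝ) j = 0}

/-- A subset of `Δⁿ` which is a union of (not necessarily proper) faces. -/
def IsSimplicialSubcomplex {n : ℕ} (A : Set (TopSimplex n)) : Prop :=
  ∃ 𝒮 : Set (Finset (Fin (n + 1))), A = ⋃ S ∈ 𝒮, faceSet n S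

/-- A singular simplex is *admissible* if the preimage of `B` is a union of faces. -/
def Admissible {X : Type*} [TopologicalSpace X] (B : Set X) {n : ℕ}
    (σ : SingularSimplex X n) : Prop :=
  IsSimplicialSubcomplex (σ ⁻¹' B)

/-- The submodule generated by admissible simplices. -/
def admissibleChains (R : Type*) [Ring R] (X : Type*) [TopologicalSpace X] (B : Set X)
    (n : ℕ) : Submodule R (SingularChain R X n) :=
  Submodule.span R {c | ∃ σ : SingularSimplex X n, Admissible B σ ∧ c = Finsupp.single σ 1}

/-- The submodule generated by simplices supported in `B`. -/
def chainsIn (R : Type*) [Ring R] (X : Type*) [TopologicalSpace X] (B : Set X)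
    (n : ℕ) : Submodule R (SingularChain R X n) :=
  Submodule.span R {c | ∃ σ : SingularSimplex X n, Set.range ⇑σ ⊆ B ∧ c = Finsupp.single σ 1}

/-- Cycles of the marked chain complex `C^M_*(X,B;R) = Ĉ^M_*(X,B;R)/C_*(B;R)`:
admissible chains whose boundary is supported in `B`. -/
def markedCycles (R : Type*) [Ring R] (X : Type*) [TopologicalSpace X] (B : Set X) :
    (n : ℕ) → Submodule R (SingularChain R X n)
  | 0 => admissibleChains R X B 0
  | (n + 1) => admissibleChains R X B (n + 1) ⊓
      Submodule.comap (boundary R X n) (chainsIn R X B n)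

/-- Boundaries of the marked chain complex. -/
def markedBoundaries (R : Type*) [Ring R] (X : Type*) [TopologicalSpace X] (B : Set X)
    (n : ℕ) : Submodule R (SingularChain R X n) :=
  Submodule.map (boundary R X n) (admissibleChains R X B (n + 1)) ⊔ chainsIn R X B n

/-- Relative cycles of the pair `(X, B)`. -/
def relativeCycles (R : Type*) [Ring R] (X : Type*) [TopologicalSpace X] (B : Set X) :
    (n : ℕ) → Submodule R (SingularChain R X n)
  | 0 => ⊤
  | (n + 1) => Submodule.comap (boundary R X n) (chainsIn R X B n)

/-- Relative boundaries of the pair `(X, B)`. -/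
def relativeBoundaries (R : Type*) [Ring R] (X : Type*) [TopologicalSpace X] (B : Set X)
    (n : ℕ) : Submodule R (SingularChain R X n) :=
  Submodule.map (boundary R X n) ⊤ ⊔ chainsIn R X B n

/-- The ℓ¹-norm of a real singular chain. -/
def l1Norm {X : Type*} [TopologicalSpace X] {n : ℕ} (c : SingularChain ℝ X n) : ℝ :=
  c.sum fun _ r => |r|

/-! ### The marked space associated to a manifold with boundary, and simplicial volumes -/

/-- The relation collapsing each connected component of `bd` to a point. -/
def collapseRel (X : Type*) (bd : Set X) [TopologicalSpace X] : X → X → Prop := fun a b =>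
  a = b ∨ (a ∈ bd ∧ b ∈ bd ∧ connectedComponentIn bd a = connectedComponentIn bd b)

/-- The quotient of `X` obtained by collapsing each connected component of `bd`
to a point. -/
abbrev Collapse (X : Type*) [TopologicalSpace X] (bd : Set X) : Type _ :=
  Quot (collapseRel X bd)

/-- The natural projection onto the collapsed space. -/
def collapseMap (X : Type*) [TopologicalSpace X] (bd : Set X) : C(X, Collapse X bd) :=
  ⟨Quot.mk _, continuous_quot_mk⟩

/-- The marked points: the images of the components of `bd`. -/
def collapsedBoundary (X : Type*) [TopologicalSpace X] (bd : Set X) : Set (Collapse X bd) :=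
  (collapseMap X bd) '' bd

/-- `ζ` is a relative fundamental cycle: it is a relative cycle which is not a relative
boundary, and whose class generates `H_n(X, bd; ℝ)`. -/
def IsFundamentalClassData (X : Type*) [TopologicalSpace X] (bd : Set X) (n : ℕ)
    (ζ : SingularChain ℝ X n) : Prop :=
  ζ ∈ relativeCycles ℝ X bd n ∧ ζ ∉ relativeBoundaries ℝ X bd n ∧
    ∀ z ∈ relativeCycles ℝ X bd n, ∃ r : ℝ, z - r • ζ ∈ relativeBoundaries ℝ X bd n

/-- `bd` admits a closed collar inside `X`. -/
def HasBoundaryCollar (X : Type*) [TopologicalSpace X] (bd : Set X) : Prop :=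
  ∃ φ : C((↥bd) × unitInterval, X), IsClosedEmbedding φ ∧ (∀ x : bd, φ (x, 0) = (x : X)) ∧
    Set.range φ ∈ nhdsSet bd ∧ ∀ (x : bd) (t : unitInterval), φ (x, t) ∈ bd ↔ t = 0

/-- Encoding of "`X` is a compact connected oriented topological `n`-manifold with
boundary `bd` and (real) relative fundamental cycle `ζ`". -/
structure IsCptMfdBdry (X : Type*) [TopologicalSpace X] (bd : Set X) (n : ℕ)
    (ζ : SingularChain ℝ X n) : Prop where
  compact : CompactSpace X
  connected : ConnectedSpace X
  bd_closed : IsClosed bd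
  collar : HasBoundaryCollar X bd
  fund : IsFundamentalClassData X bd n ζ

/-- Gromov's simplicial volume `‖M‖`: the infimum of the ℓ¹-norms of the relative cycles
representing the (class of the) relative fundamental cycle `ζ`. -/
def simplicialVolume (X : Type*) [TopologicalSpace X] (bd : Set X) (n : ℕ)
    (ζ : SingularChain ℝ X n) : ℝ :=
  sInf { r | ∃ z, z ∈ relativeCycles ℝ X bd n ∧
    z - ζ ∈ relativeBoundaries ℝ X bd n ∧ r = l1Norm z }

/-- The push-forward of the fundamental cycle to the marked space associated to `(X, bd)`. -/
def idealFundamentalRep (X : Type*) [TopologicalSpace X] (bd : Set X) (n : ℕ)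
    (ζ : SingularChain ℝ X n) : SingularChain ℝ (Collapse X bd) n :=
  pushChain ℝ (collapseMap X bd) n ζ

/-- `z` is a marked cycle representing the ideal fundamental class `[M, ∂M]^M`. -/
def IdealRepresents (X : Type*) [TopologicalSpace X] (bd : Set X) (n : ℕ)
    (ζ : SingularChain ℝ X n) (z : SingularChain ℝ (Collapse X bd) n) : Prop :=
  z ∈ markedCycles ℝ (Collapse X bd) (collapsedBoundary X bd) n ∧
    z - idealFundamentalRep X bd n ζ ∈
      relativeBoundaries ℝ (Collapse X bd) (collapsedBoundary X bd) n

/-- The ideal simplicial volume `‖M‖_I`: the infimum of the ℓ¹-norms of the marked cycles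
representing the ideal fundamental class. -/
def idealSimplicialVolume (X : Type*) [TopologicalSpace X] (bd : Set X) (n : ℕ)
    (ζ : SingularChain ℝ X n) : ℝ :=
  sInf { r | ∃ z, IdealRepresents X bd n ζ z ∧ r = l1Norm z }

/-! ### The ℓ¹-norm on finitely supported functions -/

/-- The ℓ¹-norm of a finitely supported real function. -/
def ellOne {α : Type*} (c : α →₀ ℝ) : ℝ := c.sum fun _ r => |r|

lemma ellOne_nonneg {α : Type*} (c : α →₀ ℝ) : 0 ≤ ellOne c :=
  Finset.sum_nonneg fun _ _ => abs_nonneg _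

lemma ellOne_single {α : Type*} (a : α) (r : ℝ) : ellOne (Finsupp.single a r) = |r| := by
  simp [ellOne]

lemma ellOne_add_le {α : Type*} (c d : α →₀ ℝ) : ellOne (c + d) ≤ ellOne c + ellOne d := by
  classical
  have hsum : ∀ e : α →₀ ℝ, e.support ⊆ c.support ∪ d.support →
      ellOne e = ∑ a ∈ c.support ∪ d.support, |e a| := fun e he =>
    Finsupp.sum_of_support_subset _ he _ (by simp)
  rw [hsum _ Finsupp.support_add, hsum c Finset.subset_union_left,
    hsum d Finset.subset_union_right, ← Finset.sum_add_distrib]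
  exact Finset.sum_le_sum fun a _ => abs_add_le _ _

lemma ellOne_smul {α : Type*} (r : ℝ) (c : α →₀ ℝ) : ellOne (r • c) = |r| * ellOne c := by
  unfold ellOne
  rw [Finsupp.sum_smul_index (by simp), Finsupp.mul_sum]
  simp [abs_mul]

lemma ellOne_sub_le {α : Type*} (c d : α →₀ ℝ) : ellOne (c - d) ≤ ellOne c + ellOne d := by
  have h := ellOne_add_le c ((-1 : ℝ) • d)
  rw [ellOne_smul] at h
  simpa [sub_eq_add_neg] using h

lemma ellOne_sum_le {α ι : Type*} (s : Finset ι) (f : ι → α →₀ ℝ) :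
    ellOne (∑ i ∈ s, f i) ≤ ∑ i ∈ s, ellOne (f i) :=
  Finset.le_sum_of_subadditive _ (by simp [ellOne]) ellOne_add_le s f

/-- A linear map bounded on basis elements is bounded for the ℓ¹-norm. -/
lemma ellOne_map_le {α β : Type*} (T : (α →₀ ℝ) →ₗ[ℝ] (β →₀ ℝ)) (K : ℝ) (c : α →₀ ℝ)
    (hT : ∀ a, ellOne (T (Finsupp.single a 1)) ≤ K) :
    ellOne (T c) ≤ K * ellOne c := by
  have hc : T c = ∑ a ∈ c.support, c a • T (Finsupp.single a 1) := by
    conv_lhs => rw [← Finsupp.sum_single c, Finsupp.sum, map_sum]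
    refine Finset.sum_congr rfl fun a _ => ?_
    rw [← map_smul, Finsupp.smul_single_one]
  have hK : K * ellOne c = ∑ a ∈ c.support, K * |c a| := Finset.mul_sum _ _ _
  rw [hc, hK]
  refine (ellOne_sum_le _ _).trans (Finset.sum_le_sum fun a _ => ?_)
  rw [ellOne_smul, mul_comm]
  exact mul_le_mul_of_nonneg_right (hT a) (abs_nonneg _)

lemma ellOne_mapDomain_le {α β : Type*} (f : α → β) (c : α →₀ ℝ) :
    ellOne (c.mapDomain f) ≤ ellOne c := by
  simpa using ellOne_map_le (Finsupp.lmapDomain ℝ ℝ f) 1 c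
    (by simp [ellOne_single])

/-- Membership in a submodule is stable under a linear map if it is so on basis elements. -/
lemma map_mem_of_mem_supported {α M : Type*} [AddCommGroup M] [Module ℝ M]
    (T : (α →₀ ℝ) →ₗ[ℝ] M) {s : Set α} {N : Submodule ℝ M}
    (hT : ∀ a ∈ s, T (Finsupp.single a 1) ∈ N) {c : α →₀ ℝ}
    (hc : c ∈ Finsupp.supported ℝ ℝ s) : T c ∈ N := by
  rw [Finsupp.supported_eq_span_single] at hc
  have : Submodule.span ℝ ((fun i => Finsupp.single i (1 : ℝ)) '' s) ≤ N.comap T := by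
    rw [Submodule.span_le]
    rintro _ ⟨a, ha, rfl⟩
    exact hT a ha
  exact this hc

/-! ### Alternating double sums -/

lemma sum_sum_alternating_eq_zero {M : Type*} [AddCommGroup M] [Module ℝ M] {n : ℕ}
    (g : Fin (n + 2) → Fin (n + 1) → M)
    (hg : ∀ i j : Fin (n + 1), i ≤ j → g j.succ i = g i.castSucc j) :
    ∑ i : Fin (n + 2), ∑ j : Fin (n + 1), (((-1 : ℝ) ^ (i : ℕ)) * (-1) ^ (j : ℕ)) • g i j = 0 := by
  rw [← Finset.sum_product', Finset.univ_product_univ]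
  let S : Finset (Fin (n + 2) × Fin (n + 1)) := {ij | (ij.1 : ℕ) ≤ ij.2}
  rw [← Finset.sum_add_sum_compl S, ← eq_neg_iff_add_eq_zero, ← Finset.sum_neg_distrib]
  refine Finset.sum_bij
    (fun ij hij => (ij.2.succ, ij.1.castLT
      (lt_of_le_of_lt (Finset.mem_filter.mp hij).right ij.2.is_lt))) ?_ ?_ ?_ ?_
  · rintro ⟨i, j⟩ hij
    simp only [S, Finset.compl_filter, Finset.mem_filter_univ, Fin.val_succ,
      Fin.val_castLT] at hij ⊢
    lia
  · rintro ⟨i, j⟩ hij ⟨i', j'⟩ hij' h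
    simp only [Prod.mk.injEq, Fin.succ_inj] at h
    have := congrArg Fin.val h.2
    exact Prod.ext (Fin.ext this) h.1
  · rintro ⟨i', j'⟩ hij'
    simp only [S, Finset.compl_filter, Finset.mem_filter_univ, not_le] at hij'
    have h0 : i' ≠ 0 := by
      rintro rfl
      simp at hij'
    refine ⟨(j'.castSucc, i'.pred h0), ?_, ?_⟩
    · simp only [S, Finset.mem_filter_univ, Fin.val_castSucc, Fin.val_pred]
      lia
    · simp
  · rintro ⟨i, j⟩ hij
    have hle : (i : ℕ) ≤ j := by simpa [S] using hij
    have h := hg (i.castLT (lt_of_le_of_lt hle j.is_lt)) j hle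
    dsimp only
    rw [h, ← neg_smul]
    congr 1
    simp only [Fin.val_succ, Fin.val_castLT, pow_succ]
    ring

lemma succ_succAbove_succAbove_of_le {n : ℕ} {i j : Fin (n + 2)} (h : i ≤ j) (k : Fin (n + 1)) :
    j.succ.succAbove (i.succAbove k) = i.castSucc.succAbove (j.succAbove k) := by
  have h' : (i : ℕ) ≤ j := h
  ext
  simp only [Fin.succAbove, Fin.lt_def]
  split_ifs <;> simp_all <;> lia

/-! ### Singular chains -/

section SingularChains

variable {X Y Z : Type*} [TopologicalSpace X] [TopologicalSpace Y] [TopologicalSpace Z]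

lemma chainsIn_eq_supported (B : Set X) (n : ℕ) :
    chainsIn ℝ X B n = Finsupp.supported ℝ ℝ {σ : SingularSimplex X n | Set.range σ ⊆ B} := by
  rw [Finsupp.supported_eq_span_single, chainsIn]
  congr 1
  ext c
  simp [eq_comm]

lemma admissibleChains_eq_supported (B : Set X) (n : ℕ) :
    admissibleChains ℝ X B n =
      Finsupp.supported ℝ ℝ {σ : SingularSimplex X n | Admissible B σ} := by
  rw [Finsupp.supported_eq_span_single, admissibleChains]
  congr 1
  ext c
  simp [eq_comm]

lemma single_mem_chainsIn {B : Set X} {n : ℕ} {σ : SingularSimplex X n}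
    (h : Set.range σ ⊆ B) (r : ℝ) : Finsupp.single σ r ∈ chainsIn ℝ X B n := by
  rw [chainsIn_eq_supported]
  exact Finsupp.single_mem_supported ℝ r h

lemma chainsIn_mono {A B : Set X} (h : A ⊆ B) (n : ℕ) : chainsIn ℝ X A n ≤ chainsIn ℝ X B n := by
  rw [chainsIn_eq_supported, chainsIn_eq_supported]
  exact Finsupp.supported_mono fun σ hσ => Set.Subset.trans hσ h

lemma boundary_single {n : ℕ} (σ : SingularSimplex X (n + 1)) (r : ℝ) :
    boundary ℝ X n (Finsupp.single σ r) = r • boundaryOf ℝ σ := by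
  simp [boundary]

lemma pushChain_single (f : C(X, Y)) {n : ℕ} (σ : SingularSimplex X n) (r : ℝ) :
    pushChain ℝ f n (Finsupp.single σ r) = Finsupp.single (f.comp σ) r := by
  simp [pushChain]

lemma pushChain_comp (g : C(Y, Z)) (f : C(X, Y)) {n : ℕ} (c : SingularChain ℝ X n) :
    pushChain ℝ (g.comp f) n c = pushChain ℝ g n (pushChain ℝ f n c) := by
  simp only [pushChain, Finsupp.lmapDomain_apply, ← Finsupp.mapDomain_comp]
  rfl

lemma boundary_pushChain (f : C(X, Y)) {n : ℕ} (c : SingularChain ℝ X (n + 1)) :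
    boundary ℝ Y n (pushChain ℝ f (n + 1) c) = pushChain ℝ f n (boundary ℝ X n c) := by
  induction c using Finsupp.induction_linear with
  | zero => simp
  | add a b ha hb => simp only [map_add, ha, hb]
  | single σ r =>
    simp only [pushChain_single, boundary_single, boundaryOf, map_smul, map_sum]
    rfl

lemma pushChain_mem_chainsIn (f : C(X, Y)) {A : Set X} {B : Set Y} (h : ∀ x ∈ A, f x ∈ B) {n : ℕ}
    {c : SingularChain ℝ X n} (hc : c ∈ chainsIn ℝ X A n) :
    pushChain ℝ f n c ∈ chainsIn ℝ Y B n := by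
  rw [chainsIn_eq_supported] at hc
  refine map_mem_of_mem_supported _ (fun σ hσ => ?_) hc
  rw [pushChain_single]
  refine single_mem_chainsIn ?_ 1
  rintro _ ⟨x, rfl⟩
  exact h _ (hσ ⟨x, rfl⟩)

lemma boundary_mem_chainsIn {A : Set X} {n : ℕ} {c : SingularChain ℝ X (n + 1)}
    (hc : c ∈ chainsIn ℝ X A (n + 1)) : boundary ℝ X n c ∈ chainsIn ℝ X A n := by
  rw [chainsIn_eq_supported] at hc
  refine map_mem_of_mem_supported _ (fun σ hσ => ?_) hc
  rw [boundary_single, one_smul]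
  refine Submodule.sum_mem _ fun i _ => single_mem_chainsIn ?_ _
  rintro _ ⟨x, rfl⟩
  exact hσ ⟨_, rfl⟩

lemma coface_apply {n : ℕ} (i : Fin (n + 2)) (x : TopSimplex n) (j : Fin (n + 2)) :
    (coface i x : Fin (n + 2) → ℝ) j = ∑ k, if i.succAbove k = j then x k else 0 := rfl

lemma sum_coface_smul {M : Type*} [AddCommGroup M] [Module ℝ M] {n : ℕ} (i : Fin (n + 2))
    (x : TopSimplex n) (v : Fin (n + 2) → M) :
    ∑ j, (coface i x : Fin (n + 2) → ℝ) j • v j = ∑ k, x k • v (i.succAbove k) := by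
  simp only [coface_apply, Finset.sum_smul, ite_smul, zero_smul]
  rw [Finset.sum_comm]
  simp

lemma coface_apply_succAbove {n : ℕ} (i : Fin (n + 2)) (x : TopSimplex n) (k : Fin (n + 1)) :
    (coface i x : Fin (n + 2) → ℝ) (i.succAbove k) = x k := by
  simp [coface_apply]

lemma coface_apply_self {n : ℕ} (i : Fin (n + 2)) (x : TopSimplex n) :
    (coface i x : Fin (n + 2) → ℝ) i = 0 := by
  simp [coface_apply, Fin.succAbove_ne]

lemma coface_comp_coface {n : ℕ} {i j : Fin (n + 2)} (h : i ≤ j) :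
    (coface j.succ).comp (coface i) = (coface i.castSucc).comp (coface (n := n) j) := by
  ext x l
  have key : ∀ (a : Fin (n + 3)) (b : Fin (n + 2)),
      ((coface a).comp (coface b) x : Fin (n + 3) → ℝ) l =
        ∑ k, x k • (if a.succAbove (b.succAbove k) = l then (1 : ℝ) else 0) := by
    intro a b
    rw [← sum_coface_smul b x (fun k => if a.succAbove k = l then (1 : ℝ) else 0)]
    simp [coface_apply]
  rw [key, key]
  simp only [succ_succAbove_succAbove_of_le h]

lemma boundary_boundary {n : ℕ} (c : SingularChain ℝ X (n + 2)) :
    boundary ℝ X n (boundary ℝ X (n + 1) c) = 0 := by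
  induction c using Finsupp.induction_linear with
  | zero => simp
  | add a b ha hb => simp only [map_add, ha, hb, add_zero]
  | single σ r =>
    rw [boundary_single, map_smul]
    have h := sum_sum_alternating_eq_zero (n := n + 1)
      (fun i j => (Finsupp.single ((σ.comp (coface i)).comp (coface j)) 1 : SingularChain ℝ X n))
      (fun i j hij => by
        simp only [ContinuousMap.comp_assoc, coface_comp_coface hij])
    have : boundary ℝ X n (boundaryOf ℝ σ) = 0 := by
      rw [← h]
      simp only [boundaryOf, map_sum, boundary_single, Finset.smul_sum, Finsupp.smul_single,
        smul_eq_mul, mul_one]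
    rw [this, smul_zero]

lemma relativeBoundaries_le_relativeCycles (A : Set X) (n : ℕ) :
    relativeBoundaries ℝ X A n ≤ relativeCycles ℝ X A n := by
  cases n with
  | zero => exact le_top
  | succ n =>
    refine sup_le ?_ fun c hc => boundary_mem_chainsIn hc
    rintro _ ⟨c, -, rfl⟩
    change boundary ℝ X n (boundary ℝ X (n + 1) c) ∈ chainsIn ℝ X A n
    rw [boundary_boundary]
    exact zero_mem _

lemma relativeCycles_mono {A B : Set X} (h : A ⊆ B) (n : ℕ) :
    relativeCycles ℝ X A n ≤ relativeCycles ℝ X B n := by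
  cases n with
  | zero => exact le_top
  | succ n => exact Submodule.comap_mono (chainsIn_mono h n)

lemma boundary_mem_relativeBoundaries (A : Set X) {n : ℕ} (c : SingularChain ℝ X (n + 1)) :
    boundary ℝ X n c ∈ relativeBoundaries ℝ X A n :=
  Submodule.mem_sup_left ⟨c, trivial, rfl⟩

lemma mem_relativeBoundaries_of_mem_chainsIn {A : Set X} {n : ℕ} {c : SingularChain ℝ X n}
    (hc : c ∈ chainsIn ℝ X A n) : c ∈ relativeBoundaries ℝ X A n :=
  Submodule.mem_sup_right hc

lemma mem_relativeBoundaries_iff {A : Set X} {n : ℕ} {c : SingularChain ℝ X n} :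
    c ∈ relativeBoundaries ℝ X A n ↔ ∃ e, c - boundary ℝ X n e ∈ chainsIn ℝ X A n := by
  constructor
  · intro h
    obtain ⟨_, ⟨e, -, rfl⟩, b, hb, rfl⟩ := Submodule.mem_sup.mp h
    exact ⟨e, by simpa using hb⟩
  · rintro ⟨e, he⟩
    have := add_mem (boundary_mem_relativeBoundaries A e)
      (mem_relativeBoundaries_of_mem_chainsIn he)
    simpa using this

lemma pushChain_mem_relativeBoundaries (f : C(X, Y)) {A : Set X} {B : Set Y}
    (h : ∀ x ∈ A, f x ∈ B) {n : ℕ} {c : SingularChain ℝ X n}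
    (hc : c ∈ relativeBoundaries ℝ X A n) :
    pushChain ℝ f n c ∈ relativeBoundaries ℝ Y B n := by
  obtain ⟨e, he⟩ := mem_relativeBoundaries_iff.mp hc
  refine mem_relativeBoundaries_iff.mpr ⟨pushChain ℝ f (n + 1) e, ?_⟩
  rw [boundary_pushChain, ← map_sub]
  exact pushChain_mem_chainsIn f h he

end SingularChains

/-! ### Ordered simplicial chains on a vertex type -/

/-- Real chains on ordered `k`-tuples of elements of `W`. -/
abbrev TupleChain (k : ℕ) (W : Type*) := (Fin k → W) →₀ ℝ

namespace TupleChain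

variable {W W' : Type*} {k : ℕ}

/-- The alternating sum of the tuples obtained by omitting an entry. -/
def bdry (W : Type*) (k : ℕ) : TupleChain (k + 1) W →ₗ[ℝ] TupleChain k W :=
  Finsupp.linearCombination ℝ fun v =>
    ∑ i : Fin (k + 1), Finsupp.single (v ∘ i.succAbove) ((-1 : ℝ) ^ (i : ℕ))

/-- The cone with apex `c`. -/
def cone (c : W) : TupleChain k W →ₗ[ℝ] TupleChain (k + 1) W :=
  Finsupp.lmapDomain ℝ ℝ fun v : Fin k → W => (Fin.cons c v : Fin (k + 1) → W)

/-- Push-forward along a map of vertices. -/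
def push (f : W → W') : TupleChain k W →ₗ[ℝ] TupleChain k W' :=
  Finsupp.lmapDomain ℝ ℝ (f ∘ ·)

lemma bdry_single (v : Fin (k + 1) → W) (r : ℝ) : bdry W k (Finsupp.single v r) =
    r • ∑ i : Fin (k + 1), Finsupp.single (v ∘ i.succAbove) ((-1 : ℝ) ^ (i : ℕ)) := by
  simp [bdry]

lemma cone_single (c : W) (v : Fin k → W) (r : ℝ) :
    cone c (Finsupp.single v r) = Finsupp.single (Fin.cons c v : Fin (k + 1) → W) r := by
  simp [cone]

lemma push_single (f : W → W') (v : Fin k → W) (r : ℝ) :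
    push f (Finsupp.single v r) = Finsupp.single (f ∘ v) r := by
  simp [push]

lemma push_push {W'' : Type*} (g : W' → W'') (f : W → W') (a : TupleChain k W) :
    push g (push f a) = push (g ∘ f) a := by
  simp only [push, Finsupp.lmapDomain_apply, ← Finsupp.mapDomain_comp]
  rfl

lemma bdry_push (f : W → W') (a : TupleChain (k + 1) W) :
    bdry W' k (push f a) = push f (bdry W k a) := by
  induction a using Finsupp.induction_linear with
  | zero => simp
  | add a b ha hb => simp only [map_add, ha, hb]
  | single v r =>
    simp only [push_single, bdry_single, map_smul, map_sum]
    rfl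

lemma bdry_cone (c : W) (a : TupleChain (k + 1) W) :
    bdry W (k + 1) (cone c a) = a - cone c (bdry W k a) := by
  induction a using Finsupp.induction_linear with
  | zero => simp
  | add a b ha hb =>
    simp only [map_add, ha, hb]
    abel
  | single v r =>
    rw [cone_single, bdry_single, bdry_single, Fin.sum_univ_succ, map_smul, map_sum, smul_add,
      sub_eq_add_neg, ← smul_neg, ← Finset.sum_neg_distrib]
    congr 1
    · have : (Fin.cons c v : Fin (k + 2) → W) ∘ (0 : Fin (k + 2)).succAbove = v := by
        ext j
        simp
      rw [this]
      simp
    · congr 1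
      refine Finset.sum_congr rfl fun i _ => ?_
      have : (Fin.cons c v : Fin (k + 2) → W) ∘ i.succ.succAbove =
          Fin.cons c (v ∘ i.succAbove) := by
        ext j
        refine Fin.cases ?_ (fun j => ?_) j <;> simp
      rw [this, cone_single, Fin.val_succ, pow_succ, ← Finsupp.single_neg]
      simp

lemma bdry_cone_of_bdry_eq_zero (c : W) {a : TupleChain (k + 1) W} (ha : bdry W k a = 0) :
    bdry W (k + 1) (cone c a) = a := by
  rw [bdry_cone, ha, map_zero, sub_zero]

lemma ellOne_cone_le (c : W) (a : TupleChain k W) : ellOne (cone c a) ≤ ellOne a :=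
  ellOne_mapDomain_le _ a

lemma ellOne_push_le (f : W → W') (a : TupleChain k W) : ellOne (push f a) ≤ ellOne a :=
  ellOne_mapDomain_le _ a

end TupleChain

/-! ### Subdivision and homotopy models

To each singular simplex `σ : Δᵐ → Y` we attach chains of tuples in `Δᵐ × I`. -/

section Models

open TupleChain

variable {Y Z : Type*} [TopologicalSpace Y] [TopologicalSpace Z]

/-- The vertices of the prism `Δᵐ × I` and its affine simplices. -/
abbrev Prism (m : ℕ) := TopSimplex m × unitInterval

/-- The inclusion of prisms over a face inclusion. -/
def prismCoface {m : ℕ} (i : Fin (m + 2)) : C(Prism m, Prism (m + 1)) :=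
  (coface i).prodMap (ContinuousMap.id _)

/-- The alternating sum over the faces of a family of models. -/
def faceSum {m k : ℕ} (a : SingularSimplex Y m → TupleChain k (Prism m))
    (σ : SingularSimplex Y (m + 1)) : TupleChain k (Prism (m + 1)) :=
  ∑ i : Fin (m + 2), ((-1 : ℝ) ^ (i : ℕ)) • push (prismCoface i) (a (σ.comp (coface i)))

lemma faceSum_faceSum {m k : ℕ} (a : SingularSimplex Y m → TupleChain k (Prism m))
    (σ : SingularSimplex Y (m + 2)) : faceSum (faceSum a) σ = 0 := by
  have h := sum_sum_alternating_eq_zero (n := m + 1)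
    (fun i j => push ((prismCoface i).comp (prismCoface j))
      (a ((σ.comp (coface i)).comp (coface j))))
    (fun i j hij => by
      have : (prismCoface j.succ).comp (prismCoface i) =
          (prismCoface i.castSucc).comp (prismCoface (m := m) j) := by
        ext1 x
        exact Prod.ext (DFunLike.congr_fun (coface_comp_coface hij) x.1) rfl
      simp only [ContinuousMap.comp_assoc, coface_comp_coface hij, this])
  rw [← h]
  simp only [faceSum, map_sum, map_smul, push_push, Finset.smul_sum, smul_smul]
  rfl

lemma bdry_faceSum {m k : ℕ} (a : SingularSimplex Y m → TupleChain (k + 1) (Prism m))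
    (σ : SingularSimplex Y (m + 1)) :
    bdry _ k (faceSum a σ) = faceSum (fun τ => bdry _ k (a τ)) σ := by
  simp only [faceSum, map_sum, map_smul, bdry_push]

lemma faceSum_sub {m k : ℕ} (a b : SingularSimplex Y m → TupleChain k (Prism m))
    (σ : SingularSimplex Y (m + 1)) :
    faceSum (fun τ => a τ - b τ) σ = faceSum a σ - faceSum b σ := by
  simp only [faceSum, map_sub, smul_sub, Finset.sum_sub_distrib]

/-- A choice of a point in the domain of every singular simplex. -/
abbrev CenterChoice (Y : Type*) [TopologicalSpace Y] := ∀ m, SingularSimplex Y m → TopSimplex m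

/-- The model of the subdivision with centers `c`, placed at the top of the prism. -/
def sdModel (c : CenterChoice Y) :
    ∀ m, SingularSimplex Y m → TupleChain (m + 1) (Prism m)
  | 0, σ => Finsupp.single (fun _ => (c 0 σ, 1)) 1
  | (m + 1), σ => cone (c (m + 1) σ, 1) (faceSum (sdModel c m) σ)

/-- The identity simplex, placed at the bottom of the prism. -/
def idModel (m : ℕ) : TupleChain (m + 1) (Prism m) :=
  Finsupp.single (fun i => (stdSimplex.vertex i, 0)) 1

/-- The model of the homotopy between the identity and the subdivision with centers `c`. -/
def homotopyModel (c : CenterChoice Y) :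
    ∀ m, SingularSimplex Y m → TupleChain (m + 2) (Prism m)
  | 0, σ => cone (c 0 σ, 1) (sdModel c 0 σ - idModel 0)
  | (m + 1), σ => cone (c (m + 1) σ, 1)
      (sdModel c (m + 1) σ - idModel (m + 1) - faceSum (homotopyModel c m) σ)

lemma coface_vertex {m : ℕ} (i : Fin (m + 2)) (k : Fin (m + 1)) :
    coface i (stdSimplex.vertex k) = stdSimplex.vertex (i.succAbove k) := by
  ext l
  rw [coface_apply, Finset.sum_eq_single k]
  · simp [Pi.single_apply, eq_comm]
  · intro j _ hj
    simp [hj]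
  · simp

lemma bdry_idModel (m : ℕ) (σ : SingularSimplex Y (m + 1)) :
    bdry _ _ (idModel (m + 1)) = faceSum (fun _ : SingularSimplex Y m => idModel m) σ := by
  simp only [idModel, bdry_single, faceSum, push_single, one_smul, Finsupp.smul_single,
    smul_eq_mul, mul_one]
  refine Finset.sum_congr rfl fun i _ => ?_
  congr 1
  funext k
  exact Prod.ext (coface_vertex i k).symm rfl

lemma bdry_sdModel (c : CenterChoice Y) (m : ℕ) (σ : SingularSimplex Y (m + 1)) :
    bdry _ _ (sdModel c (m + 1) σ) = faceSum (sdModel c m) σ := by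
  refine bdry_cone_of_bdry_eq_zero _ ?_
  rw [bdry_faceSum]
  cases m with
  | zero =>
    simp [faceSum, sdModel, bdry_single, push_single, Fin.sum_univ_two,
      Subsingleton.elim _ (Fin.elim0 : Fin 0 → Prism 1)]
  | succ m =>
    have : (fun τ => bdry _ _ (sdModel c (m + 1) τ)) = faceSum (sdModel c m) :=
      funext fun τ => bdry_sdModel c m τ
    rw [this, faceSum_faceSum]

lemma bdry_homotopyModel_zero (c : CenterChoice Y) (σ : SingularSimplex Y 0) :
    bdry _ _ (homotopyModel c 0 σ) = sdModel c 0 σ - idModel 0 := by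
  refine bdry_cone_of_bdry_eq_zero _ ?_
  simp [sdModel, idModel, bdry_single, Subsingleton.elim _ (Fin.elim0 : Fin 0 → Prism 0)]

lemma bdry_homotopyModel_succ (c : CenterChoice Y) (m : ℕ) (σ : SingularSimplex Y (m + 1)) :
    bdry _ _ (homotopyModel c (m + 1) σ) =
      sdModel c (m + 1) σ - idModel (m + 1) - faceSum (homotopyModel c m) σ := by
  refine bdry_cone_of_bdry_eq_zero _ ?_
  rw [map_sub, map_sub, bdry_sdModel, bdry_idModel m σ, bdry_faceSum]
  cases m with
  | zero =>
    have : (fun τ => bdry _ _ (homotopyModel c 0 τ)) = fun τ => sdModel c 0 τ - idModel 0 :=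
      funext fun τ => bdry_homotopyModel_zero c τ
    rw [this, faceSum_sub, sub_self]
  | succ m =>
    have : (fun τ => bdry _ _ (homotopyModel c (m + 1) τ)) = fun τ =>
        sdModel c (m + 1) τ - idModel (m + 1) - faceSum (homotopyModel c m) τ :=
      funext fun τ => bdry_homotopyModel_succ c m τ
    rw [this, faceSum_sub, faceSum_sub, faceSum_faceSum, sub_zero, sub_self]

lemma cone_mem_supported {W : Type*} {k : ℕ} (p : W) {s : Set (Fin k → W)}
    {t : Set (Fin (k + 1) → W)} (h : ∀ v ∈ s, (Fin.cons p v : Fin (k + 1) → W) ∈ t)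
    {a : TupleChain k W} (ha : a ∈ Finsupp.supported ℝ ℝ s) :
    cone p a ∈ Finsupp.supported ℝ ℝ t :=
  map_mem_of_mem_supported _ (fun v hv => by
    rw [cone_single]
    exact Finsupp.single_mem_supported ℝ _ (h v hv)) ha

lemma faceSum_mem_supported {m k : ℕ} {a : SingularSimplex Y m → TupleChain k (Prism m)}
    {σ : SingularSimplex Y (m + 1)} {s : SingularSimplex Y m → Set (Fin k → Prism m)}
    {t : Set (Fin k → Prism (m + 1))}
    (ha : ∀ τ, a τ ∈ Finsupp.supported ℝ ℝ (s τ))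
    (h : ∀ i, ∀ v ∈ s (σ.comp (coface i)), prismCoface i ∘ v ∈ t) :
    faceSum a σ ∈ Finsupp.supported ℝ ℝ t := by
  refine Submodule.sum_mem _ fun i _ => Submodule.smul_mem _ _ ?_
  refine map_mem_of_mem_supported _ (fun v hv => ?_) (ha (σ.comp (coface i)))
  rw [push_single]
  exact Finsupp.single_mem_supported ℝ _ (h i v hv)

/-- Induction principle for the tuples occurring in the subdivision model. -/
lemma sdModel_mem_supported (c : CenterChoice Y)
    (P : ∀ m, SingularSimplex Y m → (Fin (m + 1) → Prism m) → Prop)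
    (zero : ∀ σ, P 0 σ fun _ => (c 0 σ, 1))
    (succ : ∀ m (σ : SingularSimplex Y (m + 1)) i v, P m (σ.comp (coface i)) v →
      P (m + 1) σ (Fin.cons (c (m + 1) σ, 1) (prismCoface i ∘ v))) (m : ℕ)
    (σ : SingularSimplex Y m) : sdModel c m σ ∈ Finsupp.supported ℝ ℝ {v | P m σ v} := by
  induction m with
  | zero => exact Finsupp.single_mem_supported ℝ _ (zero σ)
  | succ m ih =>
    refine cone_mem_supported (s := {w | P (m + 1) σ (Fin.cons (c (m + 1) σ, 1) w)}) _
      (fun v hv => hv) ?_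
    exact faceSum_mem_supported ih fun i v hv => succ m σ i v hv

lemma sdModel_snd_eq_one (c : CenterChoice Y) (m : ℕ) (σ : SingularSimplex Y m) :
    sdModel c m σ ∈ Finsupp.supported ℝ ℝ {v | ∀ i, (v i).2 = 1} := by
  refine sdModel_mem_supported c (fun m _ v => ∀ i, (v i).2 = 1) (fun σ _ => rfl) ?_ m σ
  intro m σ i v hv j
  refine Fin.cases rfl (fun j => ?_) j
  exact hv j

lemma ellOne_faceSum_le {m k : ℕ} {a : SingularSimplex Y m → TupleChain k (Prism m)} {K : ℝ}
    (ha : ∀ τ, ellOne (a τ) ≤ K) (σ : SingularSimplex Y (m + 1)) :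
    ellOne (faceSum a σ) ≤ (m + 2) * K := by
  refine (ellOne_sum_le _ _).trans ?_
  refine (Finset.sum_le_sum (g := fun _ => K) fun i _ => ?_).trans (by simp)
  rw [ellOne_smul, abs_pow, abs_neg, abs_one, one_pow, one_mul]
  exact (ellOne_push_le _ _).trans (ha _)

lemma ellOne_sdModel_le (c : CenterChoice Y) (m : ℕ) (σ : SingularSimplex Y m) :
    ellOne (sdModel c m σ) ≤ (m + 1).factorial := by
  induction m with
  | zero => simp [sdModel, ellOne_single]
  | succ m ih =>
    rw [sdModel]
    refine (ellOne_cone_le _ _).trans ((ellOne_faceSum_le ih σ).trans (le_of_eq ?_))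
    rw [Nat.factorial_succ (m + 1)]
    push_cast
    ring

lemma exists_ellOne_homotopyModel_le (c : CenterChoice Y) (m : ℕ) :
    ∃ K : ℝ, ∀ σ : SingularSimplex Y m, ellOne (homotopyModel c m σ) ≤ K := by
  have hsd : ∀ m (σ : SingularSimplex Y m),
      ellOne (sdModel c m σ - idModel m) ≤ (m + 1).factorial + 1 := fun m σ =>
    (ellOne_sub_le _ _).trans
      (add_le_add (ellOne_sdModel_le c m σ) (by simp [idModel, ellOne_single]))
  induction m with
  | zero => exact ⟨(0 + 1).factorial + 1, fun σ => (ellOne_cone_le _ _).trans (hsd 0 σ)⟩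
  | succ m ih =>
    obtain ⟨K, hK⟩ := ih
    refine ⟨((m + 1 + 1).factorial + 1) + (m + 2) * K, fun σ => ?_⟩
    rw [homotopyModel]
    exact (ellOne_cone_le _ _).trans
      ((ellOne_sub_le _ _).trans (add_le_add (hsd _ σ) (ellOne_faceSum_le hK σ)))

end Models

/-! ### Realization of models -/

/-- The affine simplex in `Δᵐ` with vertices `v`. -/
def affineSimplex {k m : ℕ} (v : Fin (k + 1) → TopSimplex m) : C(TopSimplex k, TopSimplex m) where
  toFun x := ⟨∑ i, x i • (v i : Fin (m + 1) → ℝ),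
    (convex_stdSimplex ℝ _).sum_mem (fun i _ => x.2.1 i) x.2.2 fun i _ => (v i).2⟩
  continuous_toFun := by
    refine Continuous.subtype_mk (continuous_finsetSum _ fun i _ => ?_) _
    exact ((continuous_apply i).comp continuous_subtype_val).smul continuous_const

/-- The affine path-simplex in the unit interval with vertices `t`. -/
def affineInterval {k : ℕ} (t : Fin (k + 1) → unitInterval) : C(TopSimplex k, unitInterval) where
  toFun x := ⟨∑ i, x i • (t i : ℝ),
    (convex_Icc (0 : ℝ) 1).sum_mem (fun i _ => x.2.1 i) x.2.2 fun i _ => (t i).2⟩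
  continuous_toFun := by
    refine Continuous.subtype_mk (continuous_finsetSum _ fun i _ => ?_) _
    exact ((continuous_apply i).comp continuous_subtype_val).smul continuous_const

/-- The affine simplex in the prism `Δᵐ × I` with vertices `v`. -/
def affinePrism {k m : ℕ} (v : Fin (k + 1) → Prism m) : C(TopSimplex k, Prism m) :=
  (affineSimplex fun i => (v i).1).prodMk (affineInterval fun i => (v i).2)

lemma affineSimplex_apply {k m : ℕ} (v : Fin (k + 1) → TopSimplex m) (x : TopSimplex k) :
    (affineSimplex v x : Fin (m + 1) → ℝ) = ∑ i, x i • (v i : Fin (m + 1) → ℝ) := rfl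

lemma affineInterval_apply {k : ℕ} (t : Fin (k + 1) → unitInterval) (x : TopSimplex k) :
    (affineInterval t x : ℝ) = ∑ i, x i * (t i : ℝ) := rfl

lemma affineSimplex_comp_coface {k m : ℕ} (v : Fin (k + 2) → TopSimplex m) (i : Fin (k + 2)) :
    (affineSimplex v).comp (coface i) = affineSimplex (v ∘ i.succAbove) := by
  ext1 x
  exact Subtype.ext (sum_coface_smul i x _)

lemma affinePrism_comp_coface {k m : ℕ} (v : Fin (k + 2) → Prism m) (i : Fin (k + 2)) :
    (affinePrism v).comp (coface i) = affinePrism (v ∘ i.succAbove) := by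
  ext1 x
  exact Prod.ext (Subtype.ext (sum_coface_smul i x _)) (Subtype.ext (sum_coface_smul i x _))

lemma coface_affineSimplex {k m : ℕ} (v : Fin (k + 1) → TopSimplex m) (i : Fin (m + 2))
    (x : TopSimplex k) :
    coface i (affineSimplex v x) = affineSimplex (fun j => coface i (v j)) x := by
  ext l
  simp only [coface_apply, affineSimplex_apply, Finset.sum_apply, Pi.smul_apply, smul_eq_mul,
    Finset.mul_sum, mul_ite, mul_zero]
  rw [Finset.sum_comm]
  refine Finset.sum_congr rfl fun j _ => ?_
  split_ifs <;> simp

lemma affineSimplex_vertex (m : ℕ) :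
    affineSimplex (stdSimplex.vertex : Fin (m + 1) → TopSimplex m) = ContinuousMap.id _ := by
  ext x l
  simp [affineSimplex_apply, Pi.single_apply]

lemma affineInterval_const {k : ℕ} (t : unitInterval) (x : TopSimplex k) :
    affineInterval (fun _ => t) x = t := by
  refine Subtype.ext ?_
  rw [affineInterval_apply, ← Finset.sum_mul, stdSimplex.sum_eq_one, one_mul]

section ModelOperators

open TupleChain

variable {Y Z : Type*} [TopologicalSpace Y] [TopologicalSpace Z]

/-- The singular chain realizing a chain of tuples in a prism. -/
def realize {k m : ℕ} : TupleChain (k + 1) (Prism m) →ₗ[ℝ] SingularChain ℝ (Prism m) k :=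
  Finsupp.lmapDomain ℝ ℝ affinePrism

lemma realize_single {k m : ℕ} (v : Fin (k + 1) → Prism m) (r : ℝ) :
    realize (Finsupp.single v r) = Finsupp.single (affinePrism v) r := by
  simp [realize]

lemma boundary_realize {k m : ℕ} (a : TupleChain (k + 2) (Prism m)) :
    boundary ℝ _ k (realize a) = realize (bdry _ _ a) := by
  induction a using Finsupp.induction_linear with
  | zero => simp
  | add a b ha hb => simp only [map_add, ha, hb]
  | single v r =>
    simp only [realize_single, boundary_single, bdry_single, boundaryOf, map_smul, map_sum,
      affinePrism_comp_coface]

lemma realize_push {k m : ℕ} (i : Fin (m + 2)) (a : TupleChain (k + 1) (Prism m)) :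
    realize (push (prismCoface i) a) = pushChain ℝ (prismCoface i) k (realize a) := by
  induction a using Finsupp.induction_linear with
  | zero => simp
  | add a b ha hb => simp only [map_add, ha, hb]
  | single v r =>
    rw [push_single, realize_single, realize_single, pushChain_single]
    congr 1
    ext1 x
    exact Prod.ext (coface_affineSimplex _ i x).symm rfl

/-- The map of prisms induced by a singular simplex and a homotopy. -/
def prismMap (H : C(Y × unitInterval, Z)) {m : ℕ} (σ : SingularSimplex Y m) : C(Prism m, Z) :=
  H.comp (σ.prodMap (ContinuousMap.id _))

/-- The operator on singular chains induced by a homotopy and a family of models. -/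
def modelOp (H : C(Y × unitInterval, Z)) {m k : ℕ}
    (a : SingularSimplex Y m → TupleChain (k + 1) (Prism m)) :
    SingularChain ℝ Y m →ₗ[ℝ] SingularChain ℝ Z k :=
  Finsupp.linearCombination ℝ fun σ => pushChain ℝ (prismMap H σ) k (realize (a σ))

lemma modelOp_single (H : C(Y × unitInterval, Z)) {m k : ℕ}
    (a : SingularSimplex Y m → TupleChain (k + 1) (Prism m)) (σ : SingularSimplex Y m) (r : ℝ) :
    modelOp H a (Finsupp.single σ r) = r • pushChain ℝ (prismMap H σ) k (realize (a σ)) := by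
  simp [modelOp]

lemma modelOp_sub (H : C(Y × unitInterval, Z)) {m k : ℕ}
    (a b : SingularSimplex Y m → TupleChain (k + 1) (Prism m)) (c : SingularChain ℝ Y m) :
    modelOp H (fun σ => a σ - b σ) c = modelOp H a c - modelOp H b c := by
  induction c using Finsupp.induction_linear with
  | zero => simp
  | add c d hc hd =>
    simp only [map_add, hc, hd]
    abel
  | single σ r => simp only [modelOp_single, map_sub, smul_sub]

lemma boundary_modelOp (H : C(Y × unitInterval, Z)) {m k : ℕ}
    (a : SingularSimplex Y m → TupleChain (k + 2) (Prism m)) (c : SingularChain ℝ Y m) :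
    boundary ℝ Z k (modelOp H a c) = modelOp H (fun σ => bdry _ _ (a σ)) c := by
  induction c using Finsupp.induction_linear with
  | zero => simp
  | add c d hc hd => simp only [map_add, hc, hd]
  | single σ r => simp only [modelOp_single, map_smul, boundary_pushChain, boundary_realize]

lemma modelOp_boundary (H : C(Y × unitInterval, Z)) {m k : ℕ}
    (a : SingularSimplex Y m → TupleChain (k + 1) (Prism m)) (c : SingularChain ℝ Y (m + 1)) :
    modelOp H a (boundary ℝ Y m c) = modelOp H (faceSum a) c := by
  induction c using Finsupp.induction_linear with
  | zero => simp
  | add c d hc hd => simp only [map_add, hc, hd]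
  | single σ r =>
    simp only [modelOp_single, boundary_single, boundaryOf, faceSum, map_smul, map_sum,
      realize_push, ← pushChain_comp]
    rfl

/-- The simplices in the image of an operator are those described by its models. -/
lemma modelOp_single_mem (H : C(Y × unitInterval, Z)) {m k : ℕ}
    {a : SingularSimplex Y m → TupleChain (k + 1) (Prism m)} {σ : SingularSimplex Y m}
    {s : Set (Fin (k + 1) → Prism m)} (ha : a σ ∈ Finsupp.supported ℝ ℝ s)
    {T : Set (SingularSimplex Z k)} (h : ∀ v ∈ s, (prismMap H σ).comp (affinePrism v) ∈ T) :
    modelOp H a (Finsupp.single σ 1) ∈ Finsupp.supported ℝ ℝ T := by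
  rw [modelOp_single, one_smul]
  refine map_mem_of_mem_supported ((pushChain ℝ (prismMap H σ) k).comp realize) (fun v hv => ?_) ha
  rw [LinearMap.comp_apply, realize_single, pushChain_single]
  exact Finsupp.single_mem_supported ℝ _ (h v hv)

lemma modelOp_mem_chainsIn (H : C(Y × unitInterval, Z)) {m k : ℕ}
    (a : SingularSimplex Y m → TupleChain (k + 1) (Prism m)) {A : Set Y} {B : Set Z}
    (hH : ∀ y ∈ A, ∀ t, H (y, t) ∈ B) {c : SingularChain ℝ Y m} (hc : c ∈ chainsIn ℝ Y A m) :
    modelOp H a c ∈ chainsIn ℝ Z B k := by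
  rw [chainsIn_eq_supported] at hc ⊢
  refine map_mem_of_mem_supported _ (fun σ hσ => ?_) hc
  refine modelOp_single_mem H (s := Set.univ) (by simp) fun v _ => ?_
  rintro _ ⟨x, rfl⟩
  exact hH _ (hσ ⟨_, rfl⟩) _

lemma ellOne_modelOp_le (H : C(Y × unitInterval, Z)) {m k : ℕ}
    {a : SingularSimplex Y m → TupleChain (k + 1) (Prism m)} {K : ℝ}
    (ha : ∀ σ, ellOne (a σ) ≤ K) (c : SingularChain ℝ Y m) :
    ellOne (modelOp H a c) ≤ K * ellOne c := by
  refine ellOne_map_le _ K c fun σ => ?_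
  rw [modelOp_single, one_smul]
  exact (ellOne_mapDomain_le _ _).trans ((ellOne_mapDomain_le _ _).trans (ha σ))

/-- The restriction of a homotopy to a given time. -/
def homotopyAt (H : C(Y × unitInterval, Z)) (t : unitInterval) : C(Y, Z) :=
  H.comp ((ContinuousMap.id _).prodMk (ContinuousMap.const _ t))

lemma modelOp_idModel (H : C(Y × unitInterval, Z)) {m : ℕ} (c : SingularChain ℝ Y m) :
    modelOp H (fun _ => idModel m) c = pushChain ℝ (homotopyAt H 0) m c := by
  induction c using Finsupp.induction_linear with
  | zero => simp
  | add c d hc hd => simp only [map_add, hc, hd]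
  | single σ r =>
    rw [modelOp_single, idModel, realize_single, pushChain_single, pushChain_single,
      Finsupp.smul_single, smul_eq_mul, mul_one]
    congr 1
    ext1 x
    have h1 : affineSimplex (stdSimplex.vertex : Fin (m + 1) → TopSimplex m) x = x := by
      rw [affineSimplex_vertex]
      rfl
    have h2 := affineInterval_const (0 : unitInterval) x
    change H (σ (affineSimplex _ x), affineInterval _ x) = H (σ x, 0)
    rw [h1, h2]

/-- The subdivision operator with centers `c`. -/
def subdivide (c : CenterChoice Y) (m : ℕ) : SingularChain ℝ Y m →ₗ[ℝ] SingularChain ℝ Y m :=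
  modelOp ContinuousMap.fst (sdModel c m)

lemma subdivide_single_mem (c : CenterChoice Y)
    (P : ∀ m, SingularSimplex Y m → (Fin (m + 1) → TopSimplex m) → Prop)
    (zero : ∀ σ, P 0 σ fun _ => c 0 σ)
    (succ : ∀ m (σ : SingularSimplex Y (m + 1)) i v, P m (σ.comp (coface i)) v →
      P (m + 1) σ (Fin.cons (c (m + 1) σ) fun j => coface i (v j)))
    {m : ℕ} {σ : SingularSimplex Y m} {T : Set (SingularSimplex Y m)}
    (h : ∀ v, P m σ v → σ.comp (affineSimplex v) ∈ T) :
    subdivide c m (Finsupp.single σ 1) ∈ Finsupp.supported ℝ ℝ T := by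
  refine modelOp_single_mem _ (sdModel_mem_supported c (fun m σ v => P m σ fun i => (v i).1)
    zero (fun m σ i v hv => ?_) m σ) fun v hv => h _ hv
  convert succ m σ i _ hv using 1
  funext j
  refine Fin.cases rfl (fun j => rfl) j

lemma ellOne_subdivide_le (c : CenterChoice Y) {m : ℕ} (z : SingularChain ℝ Y m) :
    ellOne (subdivide c m z) ≤ (m + 1).factorial * ellOne z :=
  ellOne_modelOp_le _ (ellOne_sdModel_le c m) z

/-- Moving the subdivision to the end of a homotopy. -/
lemma modelOp_sdModel (H : C(Y × unitInterval, Z)) (c : CenterChoice Y) {m : ℕ}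
    (z : SingularChain ℝ Y m) :
    modelOp H (sdModel c m) z = pushChain ℝ (homotopyAt H 1) m (subdivide c m z) := by
  induction z using Finsupp.induction_linear with
  | zero => simp
  | add z w hz hw => simp only [map_add, hz, hw]
  | single σ r =>
    rw [subdivide, modelOp_single, modelOp_single, map_smul, ← pushChain_comp]
    congr 1
    simp only [pushChain, realize, Finsupp.lmapDomain_apply, ← Finsupp.mapDomain_comp]
    refine Finsupp.mapDomain_congr fun v hv => ?_
    have h1 : (fun i => (v i).2) = fun _ => 1 :=
      funext ((Finsupp.mem_supported ℝ _).mp (sdModel_snd_eq_one c m σ) hv)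
    ext1 x
    change H (σ (affineSimplex _ x), affineInterval _ x) = H (σ (affineSimplex _ x), 1)
    rw [h1, affineInterval_const]

lemma boundary_modelOp_homotopyModel_zero (H : C(Y × unitInterval, Z)) (c : CenterChoice Y)
    (z : SingularChain ℝ Y 0) :
    boundary ℝ Z 0 (modelOp H (homotopyModel c 0) z) =
      pushChain ℝ (homotopyAt H 1) 0 (subdivide c 0 z) - pushChain ℝ (homotopyAt H 0) 0 z := by
  rw [boundary_modelOp, funext (bdry_homotopyModel_zero c), modelOp_sub, modelOp_idModel,
    modelOp_sdModel]

lemma boundary_modelOp_homotopyModel_succ (H : C(Y × unitInterval, Z)) (c : CenterChoice Y)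
    {m : ℕ} (z : SingularChain ℝ Y (m + 1)) :
    boundary ℝ Z (m + 1) (modelOp H (homotopyModel c (m + 1)) z) =
      pushChain ℝ (homotopyAt H 1) (m + 1) (subdivide c (m + 1) z) -
        pushChain ℝ (homotopyAt H 0) (m + 1) z -
        modelOp H (homotopyModel c m) (boundary ℝ Y m z) := by
  rw [boundary_modelOp, funext (bdry_homotopyModel_succ c m), modelOp_sub, modelOp_sub,
    modelOp_idModel, modelOp_sdModel, modelOp_boundary]

lemma pushChain_subdivide_sub_mem (H : C(Y × unitInterval, Z)) (c : CenterChoice Y) {A : Set Y}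
    {B : Set Z} (hH : ∀ y ∈ A, ∀ t, H (y, t) ∈ B) {m : ℕ} {z : SingularChain ℝ Y m}
    (hz : z ∈ relativeCycles ℝ Y A m) :
    pushChain ℝ (homotopyAt H 1) m (subdivide c m z) - pushChain ℝ (homotopyAt H 0) m z ∈
      relativeBoundaries ℝ Z B m := by
  refine mem_relativeBoundaries_iff.mpr ⟨modelOp H (homotopyModel c m) z, ?_⟩
  cases m with
  | zero =>
    rw [boundary_modelOp_homotopyModel_zero, sub_self]
    exact zero_mem _
  | succ m =>
    rw [boundary_modelOp_homotopyModel_succ, sub_sub_cancel]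
    exact modelOp_mem_chainsIn H _ hH hz

lemma pushChain_id {m : ℕ} (z : SingularChain ℝ Y m) :
    pushChain ℝ (ContinuousMap.id Y) m z = z := by
  simp only [pushChain, Finsupp.lmapDomain_apply, ContinuousMap.id_comp]
  exact Finsupp.mapDomain_id

lemma subdivide_sub_mem (c : CenterChoice Y) {A : Set Y} {m : ℕ} {z : SingularChain ℝ Y m}
    (hz : z ∈ relativeCycles ℝ Y A m) :
    subdivide c m z - z ∈ relativeBoundaries ℝ Y A m := by
  have h := pushChain_subdivide_sub_mem (ContinuousMap.fst : C(Y × unitInterval, Y)) c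
    (A := A) (B := A) (fun _ hy _ => hy) hz
  have hid : ∀ t, homotopyAt (ContinuousMap.fst : C(Y × unitInterval, Y)) t =
    ContinuousMap.id Y := fun t => rfl
  rwa [hid, hid, pushChain_id, pushChain_id] at h

/-- The barycentric choice of centers. -/
def barycentric (Y : Type*) [TopologicalSpace Y] : CenterChoice Y :=
  fun _ _ => stdSimplex.barycenter

/-- Homotopy invariance of relative homology. -/
lemma pushChain_homotopy_sub_mem (H : C(Y × unitInterval, Z)) {A : Set Y}
    {B : Set Z} (hH : ∀ y ∈ A, ∀ t, H (y, t) ∈ B) {m : ℕ} {z : SingularChain ℝ Y m}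
    (hz : z ∈ relativeCycles ℝ Y A m) :
    pushChain ℝ (homotopyAt H 1) m z - pushChain ℝ (homotopyAt H 0) m z ∈
      relativeBoundaries ℝ Z B m := by
  have h1 := pushChain_subdivide_sub_mem H (barycentric Y) hH hz
  have h2 := pushChain_mem_relativeBoundaries (homotopyAt H 1) (B := B) (fun y hy => hH y hy 1)
    (subdivide_sub_mem (barycentric Y) hz)
  rw [map_sub] at h2
  have := sub_mem h1 h2
  rwa [sub_sub_sub_cancel_left] at this

/-- Replacing a chain by its subdivision in a relative bounding relation. -/
lemma sub_boundary_subdivide_mem (c : CenterChoice Y) {A : Set Y} {m : ℕ}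
    {u : SingularChain ℝ Y m} {e : SingularChain ℝ Y (m + 1)}
    (h : u - boundary ℝ Y m e ∈ chainsIn ℝ Y A m) :
    u - boundary ℝ Y m (subdivide c (m + 1) e -
      modelOp ContinuousMap.fst (homotopyModel c m) u) ∈ chainsIn ℝ Y A m := by
  set D : SingularChain ℝ Y m →ₗ[ℝ] SingularChain ℝ Y (m + 1) :=
    modelOp ContinuousMap.fst (homotopyModel c m) with hD
  have h1 := congrArg (boundary ℝ Y m) (boundary_modelOp_homotopyModel_succ
    (ContinuousMap.fst : C(Y × unitInterval, Y)) c e)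
  have hid : ∀ t, homotopyAt (ContinuousMap.fst : C(Y × unitInterval, Y)) t =
    ContinuousMap.id Y := fun t => rfl
  rw [hid, hid, pushChain_id, pushChain_id, boundary_boundary, map_sub, map_sub, ← hD] at h1
  have h2 : boundary ℝ Y m (D (u - boundary ℝ Y m e)) ∈ chainsIn ℝ Y A m :=
    boundary_mem_chainsIn (modelOp_mem_chainsIn _ _ (fun _ hy _ => hy) h)
  have h3 := add_mem h h2
  convert h3 using 1
  rw [map_sub, map_sub, map_sub]
  have h4 : boundary ℝ Y m (subdivide c (m + 1) e) =
      boundary ℝ Y m e + boundary ℝ Y m (D (boundary ℝ Y m e)) := by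
    rw [eq_comm, sub_sub, sub_eq_zero] at h1
    exact h1
  rw [h4]
  abel

end ModelOperators

/-! ### Small simplices -/

section SmallSimplices

variable {E : Type*} [NormedAddCommGroup E] [NormedSpace ℝ E]

lemma norm_sub_sum_smul_le {k : ℕ} (x : TopSimplex k) (u : Fin (k + 1) → E) (b : E) {d : ℝ}
    (h : ∀ i, ‖b - u i‖ ≤ d) : ‖b - ∑ i, x i • u i‖ ≤ d := by
  have h1 : b - ∑ i, x i • u i = ∑ i, x i • (b - u i) := by
    simp only [smul_sub, Finset.sum_sub_distrib, ← Finset.sum_smul, stdSimplex.sum_eq_one, one_smul]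
  rw [h1]
  calc ‖∑ i, x i • (b - u i)‖ ≤ ∑ i, x i * d := by
        refine norm_sum_le_of_le _ fun i _ => ?_
        rw [norm_smul, Real.norm_of_nonneg (stdSimplex.zero_le x i)]
        exact mul_le_mul_of_nonneg_left (h i) (stdSimplex.zero_le x i)
    _ = d := by rw [← Finset.sum_mul, stdSimplex.sum_eq_one, one_mul]

lemma norm_barycenter_sub_le {k : ℕ} (u : Fin (k + 1) → E) {d : ℝ}
    (h : ∀ i j, ‖u i - u j‖ ≤ d) (l : Fin (k + 1)) :
    ‖∑ i, (stdSimplex.barycenter : TopSimplex k) i • u i - u l‖ ≤ k / (k + 1) * d := by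
  have h1 : ∑ i, (stdSimplex.barycenter : TopSimplex k) i • u i - u l =
      ∑ i, (k + 1 : ℝ)⁻¹ • (u i - u l) := by
    have h2 : ∑ i : Fin (k + 1), (k + 1 : ℝ)⁻¹ • u l = u l := by
      rw [← Finset.sum_smul, Finset.sum_const, Finset.card_univ, Fintype.card_fin, nsmul_eq_mul]
      push_cast
      rw [mul_inv_cancel₀ (by positivity), one_smul]
    simp only [smul_sub, Finset.sum_sub_distrib, h2]
    congr 1
    refine Finset.sum_congr rfl fun i _ => ?_
    have h3 : (stdSimplex.barycenter : TopSimplex k) i = (Fintype.card (Fin (k + 1)) : ℝ)⁻¹ := rfl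
    rw [h3, Fintype.card_fin, Nat.cast_succ]
  rw [h1, Fin.sum_univ_succAbove _ l, sub_self, smul_zero, zero_add]
  calc ‖∑ i, (k + 1 : ℝ)⁻¹ • (u (l.succAbove i) - u l)‖ ≤ ∑ _i : Fin k, (k + 1 : ℝ)⁻¹ * d := by
        refine norm_sum_le_of_le _ fun i _ => ?_
        rw [norm_smul, Real.norm_of_nonneg (by positivity)]
        exact mul_le_mul_of_nonneg_left (h _ _) (by positivity)
    _ = k / (k + 1) * d := by
        rw [Finset.sum_const, Finset.card_univ, Fintype.card_fin, nsmul_eq_mul]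
        ring

/-- Every affine image of the tuple `v` of points of `Δᵐ` shrinks by the factor `m / (m + 1)`. -/
def Shrinks {m : ℕ} (E : Type*) [NormedAddCommGroup E] [NormedSpace ℝ E]
    (v : Fin (m + 1) → TopSimplex m) : Prop :=
  ∀ (u : Fin (m + 1) → E) (d : ℝ), (∀ i j, ‖u i - u j‖ ≤ d) →
    ∀ i j, ‖∑ l, v i l • u l - ∑ l, v j l • u l‖ ≤ m / (m + 1) * d

lemma Shrinks.cons {m : ℕ} {v : Fin (m + 1) → TopSimplex m} (hv : Shrinks E v) (i : Fin (m + 2)) :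
    Shrinks E (Fin.cons stdSimplex.barycenter fun j => coface i (v j) :
      Fin (m + 2) → TopSimplex (m + 1)) := by
  intro u d hu
  have hd : 0 ≤ d := (norm_nonneg _).trans (hu 0 0)
  have key (x : TopSimplex (m + 1)) :
      ‖∑ l, (stdSimplex.barycenter : TopSimplex (m + 1)) l • u l - ∑ l, x l • u l‖ ≤
        ((m + 1 : ℕ) : ℝ) / ((m + 1 : ℕ) + 1) * d :=
    norm_sub_sum_smul_le x u _ (norm_barycenter_sub_le u hu)
  intro a b
  refine Fin.cases ?_ (fun a => ?_) a
  · exact key _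
  · refine Fin.cases ?_ (fun b => ?_) b
    · rw [norm_sub_rev]
      exact key _
    · simp only [Fin.cons_succ]
      rw [sum_coface_smul, sum_coface_smul]
      refine (hv _ d (fun _ _ => hu _ _) a b).trans (mul_le_mul_of_nonneg_right ?_ hd)
      rw [div_le_div_iff₀ (by positivity) (by positivity)]
      push_cast
      nlinarith

variable {Y : Type*} [TopologicalSpace Y]

lemma affineSimplex_comp {k l m : ℕ} (u : Fin (l + 1) → TopSimplex m)
    (v : Fin (k + 1) → TopSimplex l) :
    (affineSimplex u).comp (affineSimplex v) = affineSimplex fun i => affineSimplex u (v i) := by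
  ext x a
  simp only [ContinuousMap.comp_apply, affineSimplex_apply, Finset.sum_apply, Pi.smul_apply,
    smul_eq_mul, Finset.sum_mul, Finset.mul_sum]
  rw [Finset.sum_comm]
  simp only [mul_assoc]

lemma subdivide_pow_single_mem {m : ℕ} (σ : SingularSimplex Y m) (N : ℕ) :
    (subdivide (barycentric Y) m ^ N) (Finsupp.single σ 1) ∈ Finsupp.supported ℝ ℝ
      {τ | ∃ u : Fin (m + 1) → TopSimplex m,
        (∀ i j, ‖(u i : Fin (m + 1) → ℝ) - u j‖ ≤ (m / (m + 1) : ℝ) ^ N) ∧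
          τ = σ.comp (affineSimplex u)} := by
  induction N with
  | zero =>
    refine Finsupp.single_mem_supported ℝ _ ⟨stdSimplex.vertex, fun i j => ?_, ?_⟩
    · rw [pow_zero, pi_norm_le_iff_of_nonneg zero_le_one]
      intro l
      simp only [stdSimplex.vertex_coe, Pi.sub_apply, Pi.single_apply]
      split_ifs <;> simp
    · rw [affineSimplex_vertex, ContinuousMap.comp_id]
  | succ N ih =>
    rw [pow_succ' (subdivide (barycentric Y) m), Module.End.mul_apply]
    refine map_mem_of_mem_supported _ ?_ ih
    rintro _ ⟨u, hu, rfl⟩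
    refine subdivide_single_mem (barycentric Y) (fun m' _ v => Shrinks (Fin (m + 1) → ℝ) v)
      ?_ (fun _ _ i v hv => hv.cons i) fun v hv => ⟨fun i => affineSimplex u (v i), ?_, ?_⟩
    · intro _ u d hu i j
      simp
    · intro i j
      rw [pow_succ', affineSimplex_apply, affineSimplex_apply]
      exact hv _ _ hu i j
    · rw [ContinuousMap.comp_assoc, affineSimplex_comp]

/-- The simplices contained in some member of the cover `c`. -/
def smallSimplices {ι : Type*} (c : ι → Set Y) (m : ℕ) : Set (SingularSimplex Y m) :=
  {τ | ∃ i, Set.range τ ⊆ c i}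

lemma eventually_subdivide_pow_mem {ι : Type*} {c : ι → Set Y} (hc : ∀ i, IsOpen (c i))
    (hcov : ⋃ i, c i = Set.univ) {m : ℕ} (e : SingularChain ℝ Y m) :
    ∀ᶠ N in Filter.atTop, (subdivide (barycentric Y) m ^ N) e ∈
      Finsupp.supported ℝ ℝ (smallSimplices c m) := by
  induction e using Finsupp.induction_linear with
  | zero => simp
  | add e f he hf =>
    filter_upwards [he, hf] with N h1 h2
    rw [map_add]
    exact add_mem h1 h2
  | single σ r =>
    obtain ⟨δ, hδ, hball⟩ := lebesgue_number_lemma_of_metric (isCompact_univ : IsCompact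
      (Set.univ : Set (TopSimplex m))) (c := fun i => σ ⁻¹' c i)
      (fun i => (hc i).preimage σ.continuous)
      (by rw [← Set.preimage_iUnion, hcov, Set.preimage_univ])
    have hlim : Filter.Tendsto (fun N : ℕ => (m / (m + 1) : ℝ) ^ N) Filter.atTop (𝓝 0) :=
      tendsto_pow_atTop_nhds_zero_of_lt_one (by positivity)
        ((div_lt_one (by positivity)).mpr (by linarith))
    filter_upwards [hlim.eventually (gt_mem_nhds hδ)] with N hN
    rw [← mul_one r, ← smul_eq_mul, ← Finsupp.smul_single, map_smul]
    refine Submodule.smul_mem _ _ (Finsupp.supported_mono ?_ (subdivide_pow_single_mem σ N))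
    rintro _ ⟨u, hu, rfl⟩
    obtain ⟨i, hi⟩ := hball (u 0) trivial
    refine ⟨i, ?_⟩
    rintro _ ⟨x, rfl⟩
    refine hi (a := affineSimplex u x) ?_
    rw [Metric.mem_ball, Subtype.dist_eq, dist_eq_norm, norm_sub_rev]
    exact (norm_sub_sum_smul_le x _ _ (hu 0)).trans_lt hN

lemma modelOp_fst_mem_small {ι : Type*} {c : ι → Set Y} {m k : ℕ}
    (a : SingularSimplex Y m → TupleChain (k + 1) (Prism m)) {z : SingularChain ℝ Y m}
    (hz : z ∈ Finsupp.supported ℝ ℝ (smallSimplices c m)) :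
    modelOp ContinuousMap.fst a z ∈ Finsupp.supported ℝ ℝ (smallSimplices c k) := by
  refine map_mem_of_mem_supported _ (fun σ hσ => ?_) hz
  obtain ⟨i, hi⟩ := hσ
  refine modelOp_single_mem _ (s := Set.univ) (by simp) fun v _ => ⟨i, ?_⟩
  rintro _ ⟨x, rfl⟩
  exact hi ⟨_, rfl⟩

/-- A bounding chain of a small chain can be chosen small. -/
lemma exists_small_bounding {ι : Type*} {c : ι → Set Y} (hc : ∀ i, IsOpen (c i))
    (hcov : ⋃ i, c i = Set.univ) {A : Set Y} {m : ℕ} {u : SingularChain ℝ Y m}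
    (hu : u ∈ Finsupp.supported ℝ ℝ (smallSimplices c m)) (h : u ∈ relativeBoundaries ℝ Y A m) :
    ∃ e ∈ Finsupp.supported ℝ ℝ (smallSimplices c (m + 1)),
      u - boundary ℝ Y m e ∈ chainsIn ℝ Y A m := by
  obtain ⟨e, he⟩ := mem_relativeBoundaries_iff.mp h
  have key : ∀ N : ℕ, ∃ f, u - boundary ℝ Y m f ∈ chainsIn ℝ Y A m ∧
      f - (subdivide (barycentric Y) (m + 1) ^ N) e ∈
        Finsupp.supported ℝ ℝ (smallSimplices c (m + 1)) := by
    intro N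
    induction N with
    | zero => exact ⟨e, he, by simp⟩
    | succ N ih =>
      obtain ⟨f, hf, hfN⟩ := ih
      refine ⟨_, sub_boundary_subdivide_mem (barycentric Y) hf, ?_⟩
      rw [pow_succ', Module.End.mul_apply, sub_right_comm, ← map_sub]
      exact sub_mem (modelOp_fst_mem_small _ hfN) (modelOp_fst_mem_small _ hu)
  obtain ⟨N, hN⟩ := (eventually_subdivide_pow_mem hc hcov e).exists
  obtain ⟨f, hf, hfN⟩ := key N
  exact ⟨f, by simpa using add_mem hfN hN, hf⟩

/-- A chain of simplices each lying in `A` or in `B` splits without increasing the norm. -/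
lemma exists_split_of_small {A B : Set Y} {m : ℕ} {z : SingularChain ℝ Y m}
    (hz : z ∈ Finsupp.supported ℝ ℝ (smallSimplices (fun b : Bool => cond b A B) m)) :
    ∃ a ∈ chainsIn ℝ Y A m, z - a ∈ chainsIn ℝ Y B m ∧ ellOne a ≤ ellOne z := by
  classical
  refine ⟨z.filter fun τ => Set.range τ ⊆ A, ?_, ?_, ?_⟩
  · rw [chainsIn_eq_supported, Finsupp.mem_supported, Finsupp.support_filter]
    intro τ hτ
    exact (Finset.mem_filter.mp hτ).2
  · rw [chainsIn_eq_supported, Finsupp.mem_supported']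
    intro τ hτ
    rw [Finsupp.sub_apply, Finsupp.filter_apply]
    split_ifs with h
    · simp
    · rw [sub_zero]
      refine (Finsupp.mem_supported' ℝ z).mp hz τ ?_
      rintro ⟨b, hb⟩
      cases b
      · exact hτ hb
      · exact h hb
  · rw [ellOne, ellOne, Finsupp.sum, Finsupp.sum, Finsupp.support_filter]
    refine (Finset.sum_le_sum_of_subset_of_nonneg (Finset.filter_subset _ _)
      fun _ _ _ => abs_nonneg _).trans' (Finset.sum_le_sum fun τ hτ => ?_)
    rw [Finsupp.filter_apply_pos (fun τ : SingularSimplex Y m => Set.range τ ⊆ A) z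
      (Finset.mem_filter.mp hτ).2]

end SmallSimplices

/-! ### Subdividing admissible simplices -/

section AdmissibleSimplices

variable {Y : Type*} [TopologicalSpace Y] {B : Set Y}

lemma coface_mem_faceSet_iff {m : ℕ} (i : Fin (m + 2)) (S : Finset (Fin (m + 2)))
    (x : TopSimplex m) :
    coface i x ∈ faceSet (m + 1) S ↔
      x ∈ faceSet m (Finset.univ.filter fun k => i.succAbove k ∈ S) := by
  simp only [faceSet, Set.mem_ofPred_eq, Finset.mem_filter, Finset.mem_univ, true_and]
  refine ⟨fun h k hk => ?_, fun h j hj => ?_⟩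
  · exact (coface_apply_succAbove i x k).symm.trans (h _ hk)
  · rcases Fin.eq_self_or_eq_succAbove i j with rfl | ⟨k, rfl⟩
    · exact coface_apply_self j x
    · exact (coface_apply_succAbove i x k).trans (h k hj)

lemma Admissible.comp_coface {m : ℕ} {σ : SingularSimplex Y (m + 1)} (h : Admissible B σ)
    (i : Fin (m + 2)) : Admissible B (σ.comp (coface i)) := by
  obtain ⟨𝒮, h𝒮⟩ := h
  refine ⟨(fun S => Finset.univ.filter fun k => i.succAbove k ∈ S) '' 𝒮, ?_⟩
  ext x
  have := Set.ext_iff.mp h𝒮 (coface i x)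
  simp only [Set.mem_preimage, Set.mem_iUnion, coface_mem_faceSet_iff] at this
  simpa using this

lemma exists_coface_eq {m : ℕ} (i : Fin (m + 2)) (x : TopSimplex (m + 1)) (h : x i = 0) :
    ∃ y : TopSimplex m, coface i y = x := by
  have hsum : ∑ k, x (i.succAbove k) = 1 := by
    have := stdSimplex.sum_eq_one x
    rwa [Fin.sum_univ_succAbove _ i, h, zero_add] at this
  refine ⟨⟨fun k => x (i.succAbove k), fun k => stdSimplex.zero_le x _, hsum⟩, ?_⟩
  ext j
  rcases Fin.eq_self_or_eq_succAbove i j with rfl | ⟨k, rfl⟩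
  · exact (coface_apply_self _ _).trans h.symm
  · exact coface_apply_succAbove _ _ _

lemma notMem_faceSet_empty {m : ℕ} (x : TopSimplex m) : x ∉ faceSet m ∅ := by
  intro h
  have h1 : ∑ i, x i = 0 := Finset.sum_eq_zero fun i _ => h i (Finset.notMem_empty i)
  exact one_ne_zero ((stdSimplex.sum_eq_one x).symm.trans h1)

lemma mem_faceSet_univ {m : ℕ} (x : TopSimplex m) : x ∈ faceSet m Finset.univ :=
  fun j hj => absurd (Finset.mem_univ j) hj

lemma mem_faceSet_image_succ_iff {m : ℕ} (S : Finset (Fin (m + 1))) (x : TopSimplex m) :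
    coface 0 x ∈ faceSet (m + 1) (S.image Fin.succ) ↔ x ∈ faceSet m S := by
  rw [coface_mem_faceSet_iff]
  congr!
  ext k
  simp

/-- The simplices for which the preimage of `B` is a single (possibly empty) face. -/
def singleFaceSimplices (B : Set Y) (m : ℕ) : Set (SingularSimplex Y m) :=
  {τ | ∃ S, ∀ x, τ x ∈ B ↔ x ∈ faceSet m S}

lemma Admissible.eq_univ_of_pos {m : ℕ} {σ : SingularSimplex Y m} (h : Admissible B σ)
    {x : TopSimplex m} (hx : ∀ j, 0 < x j) (hxB : σ x ∈ B) (y : TopSimplex m) : σ y ∈ B := by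
  obtain ⟨𝒮, h𝒮⟩ := h
  have h1 : x ∈ ⋃ S ∈ 𝒮, faceSet m S := h𝒮 ▸ hxB
  simp only [Set.mem_iUnion] at h1
  obtain ⟨S, hS, hxS⟩ := h1
  have h2 : y ∈ ⋃ S ∈ 𝒮, faceSet m S := by
    simp only [Set.mem_iUnion]
    refine ⟨S, hS, fun j hj => ?_⟩
    exact absurd (hxS j hj) (hx j).ne'
  rwa [← h𝒮] at h2

lemma subdivide_barycentric_mem {m : ℕ} {z : SingularChain ℝ Y m}
    (hz : z ∈ admissibleChains ℝ Y B m) :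
    subdivide (barycentric Y) m z ∈ Finsupp.supported ℝ ℝ (singleFaceSimplices B m) := by
  rw [admissibleChains_eq_supported] at hz
  refine map_mem_of_mem_supported _ (fun σ hσ => ?_) hz
  refine subdivide_single_mem (barycentric Y)
    (fun m σ v => Admissible B σ → σ.comp (affineSimplex v) ∈ singleFaceSimplices B m)
    (fun σ _ => ?_) (fun m σ i v hv hσ => ?_) fun v hv => hv hσ
  · by_cases h : σ stdSimplex.barycenter ∈ B
    · refine ⟨Finset.univ, fun x => ⟨fun _ => mem_faceSet_univ x, fun _ => ?_⟩⟩
      rwa [Subsingleton.elim x stdSimplex.barycenter, ContinuousMap.comp_apply,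
        Subsingleton.elim (affineSimplex _ _) stdSimplex.barycenter]
    · refine ⟨∅, fun x => ⟨fun hx => absurd ?_ h, fun hx => absurd hx (notMem_faceSet_empty x)⟩⟩
      rwa [ContinuousMap.comp_apply,
        Subsingleton.elim (affineSimplex _ _) stdSimplex.barycenter] at hx
  · by_cases hall : ∀ y, σ y ∈ B
    · exact ⟨Finset.univ, fun x => ⟨fun _ => mem_faceSet_univ x, fun _ => hall _⟩⟩
    · obtain ⟨S, hS⟩ := hv (hσ.comp_coface i)
      refine ⟨S.image Fin.succ, fun x => ?_⟩
      by_cases hx : x 0 = 0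
      · obtain ⟨x, rfl⟩ := exists_coface_eq 0 x hx
        rw [mem_faceSet_image_succ_iff, ← hS, ContinuousMap.comp_apply, ContinuousMap.comp_apply,
          ContinuousMap.comp_apply, coface_affineSimplex, ← ContinuousMap.comp_apply _ (coface 0),
          affineSimplex_comp_coface]
        rfl
      · refine ⟨fun h => absurd (hσ.eq_univ_of_pos (fun j => ?_) h) hall,
          fun h => absurd (h 0 (by simp)) hx⟩
        have h0 : 0 < x 0 := lt_of_le_of_ne (stdSimplex.zero_le x 0) (Ne.symm hx)
        rw [affineSimplex_apply, Finset.sum_apply, Fin.sum_univ_succ]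
        refine add_pos_of_pos_of_nonneg (mul_pos h0 ?_) (Finset.sum_nonneg fun k _ =>
          mul_nonneg (stdSimplex.zero_le _ _) (stdSimplex.zero_le _ _))
        change (0 : ℝ) < (Fintype.card (Fin (m + 1 + 1)) : ℝ)⁻¹
        rw [Fintype.card_fin]
        positivity

open Classical in
/-- The sum of the barycentric coordinates at the vertices outside `B`. -/
def outerWeight (B : Set Y) {m : ℕ} (σ : SingularSimplex Y m) (x : TopSimplex m) : ℝ :=
  ∑ j, x j • if σ (stdSimplex.vertex j) ∈ B then (0 : ℝ) else 1

lemma outerWeight_nonneg {m : ℕ} (σ : SingularSimplex Y m) (x : TopSimplex m) :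
    0 ≤ outerWeight B σ x := by
  refine Finset.sum_nonneg fun j _ => smul_nonneg (stdSimplex.zero_le x j) ?_
  split_ifs <;> simp

lemma continuous_outerWeight {m : ℕ} (σ : SingularSimplex Y m) :
    Continuous (outerWeight B σ) :=
  continuous_finsetSum _ fun j _ =>
    ((continuous_apply j).comp continuous_subtype_val).smul continuous_const

lemma outerWeight_coface {m : ℕ} (σ : SingularSimplex Y (m + 1)) (i : Fin (m + 2))
    (x : TopSimplex m) : outerWeight B σ (coface i x) = outerWeight B (σ.comp (coface i)) x := by
  rw [outerWeight, sum_coface_smul]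
  refine Finset.sum_congr rfl fun k _ => ?_
  congr! 3
  rw [ContinuousMap.comp_apply, coface_vertex]

lemma outerWeight_affineSimplex {k m : ℕ} (σ : SingularSimplex Y m)
    (v : Fin (k + 1) → TopSimplex m) (x : TopSimplex k) :
    outerWeight B σ (affineSimplex v x) = ∑ i, x i * outerWeight B σ (v i) := by
  simp only [outerWeight, affineSimplex_apply, Finset.sum_apply, Pi.smul_apply, smul_eq_mul,
    Finset.sum_mul, Finset.mul_sum]
  rw [Finset.sum_comm]
  simp only [mul_assoc]

lemma outerWeight_vertex {m : ℕ} (σ : SingularSimplex Y m) (j : Fin (m + 1))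
    [Decidable (σ (stdSimplex.vertex j) ∈ B)] :
    outerWeight B σ (stdSimplex.vertex j) = if σ (stdSimplex.vertex j) ∈ B then 0 else 1 := by
  rw [outerWeight, Finset.sum_eq_single j]
  · simp
  · intro k _ hk
    simp [hk]
  · simp

lemma exists_notMem_of_outerWeight_pos {m : ℕ} {σ : SingularSimplex Y m} {x : TopSimplex m}
    (h : 0 < outerWeight B σ x) : ∃ j, σ (stdSimplex.vertex j) ∉ B := by
  by_contra! hj
  simp [outerWeight, hj] at h

lemma outerWeight_eq_one {m : ℕ} {σ : SingularSimplex Y m} (x : TopSimplex m)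
    (h : ∀ j, σ (stdSimplex.vertex j) ∉ B) : outerWeight B σ x = 1 := by
  simp [outerWeight, h]

lemma exists_center {ε : ℝ} (hε : 0 < ε) {m : ℕ} (σ : SingularSimplex Y m) :
    ∃ x : TopSimplex m, (∀ j, σ (stdSimplex.vertex j) ∉ B → 0 < outerWeight B σ x) ∧
      (∀ j, σ (stdSimplex.vertex j) ∈ B → outerWeight B σ x < ε) := by
  classical
  by_cases h1 : ∃ j, σ (stdSimplex.vertex j) ∉ B
  · obtain ⟨j, hj⟩ := h1
    by_cases h2 : ∃ k, σ (stdSimplex.vertex k) ∈ B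
    · obtain ⟨k, hk⟩ := h2
      have hδ : 0 < min (ε / 2) 1 := by positivity
      have hδ1 : min (ε / 2) 1 ≤ 1 := min_le_right _ _
      have hδε : min (ε / 2) 1 < ε := (min_le_left _ _).trans_lt (by linarith)
      generalize min (ε / 2) 1 = δ at hδ hδ1 hδε
      let y : TopSimplex 1 := ⟨![δ, 1 - δ], by
        refine ⟨fun i => ?_, by simp⟩
        fin_cases i
        · exact hδ.le
        · simpa using hδ1⟩
      have hy : outerWeight B σ (affineSimplex ![stdSimplex.vertex j, stdSimplex.vertex k] y) =
          δ := by
        rw [outerWeight_affineSimplex, Fin.sum_univ_two]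
        simp only [Matrix.cons_val_zero, Matrix.cons_val_one, outerWeight_vertex, if_neg hj,
          if_pos hk, mul_one, mul_zero, add_zero]
        rfl
      exact ⟨_, fun _ _ => hy ▸ hδ, fun _ _ => hy ▸ hδε⟩
    · exact ⟨stdSimplex.vertex j, fun _ _ => by simp [outerWeight_vertex, hj],
        fun k hk => absurd ⟨k, hk⟩ h2⟩
  · push Not at h1
    refine ⟨stdSimplex.vertex 0, fun j hj => absurd (h1 j) hj, fun _ _ => ?_⟩
    simpa [outerWeight_vertex, h1 0] using hε

/-- A choice of centers separating the vertices in `B` from the others. -/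
def separatingCenters (B : Set Y) {ε : ℝ} (hε : 0 < ε) : CenterChoice Y :=
  fun _ σ => (exists_center (B := B) hε σ).choose

lemma subdivide_separating_single_mem {ε : ℝ} (hε : 0 < ε) {m : ℕ} {σ : SingularSimplex Y m}
    {T : Set (SingularSimplex Y m)}
    (h : ∀ v, (∀ i, 0 < outerWeight B σ (v i)) ∨ (∀ i, outerWeight B σ (v i) < ε) →
      σ.comp (affineSimplex v) ∈ T) :
    subdivide (separatingCenters B hε) m (Finsupp.single σ 1) ∈ Finsupp.supported ℝ ℝ T := by
  have hc (m : ℕ) (σ : SingularSimplex Y m) := (exists_center (B := B) hε σ).choose_spec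
  refine subdivide_single_mem _ (fun m σ v => (∀ i, 0 < outerWeight B σ (v i)) ∨
    (∀ i, outerWeight B σ (v i) < ε)) (fun σ => ?_) (fun m σ i v hv => ?_) h
  · by_cases h0 : σ (stdSimplex.vertex 0) ∈ B
    · exact Or.inr fun _ => (hc 0 σ).2 0 h0
    · exact Or.inl fun _ => (hc 0 σ).1 0 h0
  · by_cases hB : ∃ j, σ (stdSimplex.vertex j) ∈ B
    · obtain ⟨j, hj⟩ := hB
      rcases hv with hv | hv
      · refine Or.inl (Fin.cases ?_ fun l => ?_)
        · obtain ⟨l, hl⟩ := exists_notMem_of_outerWeight_pos (hv 0)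
          rw [ContinuousMap.comp_apply, coface_vertex] at hl
          exact (hc _ σ).1 _ hl
        · rw [Fin.cons_succ, outerWeight_coface]
          exact hv l
      · refine Or.inr (Fin.cases ?_ fun l => ?_)
        · exact (hc _ σ).2 _ hj
        · rw [Fin.cons_succ, outerWeight_coface]
          exact hv l
    · push Not at hB
      exact Or.inl fun l => by simp [outerWeight_eq_one _ hB]

lemma mem_iff_outerWeight_eq_zero {m : ℕ} {τ : SingularSimplex Y m}
    (hτ : τ ∈ singleFaceSimplices B m) (x : TopSimplex m) : τ x ∈ B ↔ outerWeight B τ x = 0 := by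
  obtain ⟨S, hS⟩ := hτ
  have hv (j : Fin (m + 1)) : τ (stdSimplex.vertex j) ∈ B ↔ j ∈ S := by
    rw [hS]
    refine ⟨fun h => ?_, fun h k hk => ?_⟩
    · by_contra hj
      simpa using h j hj
    · have : k ≠ j := fun hkj => hk (hkj ▸ h)
      simp [this]
  rw [hS, outerWeight, Finset.sum_eq_zero_iff_of_nonneg]
  · simp only [hv, faceSet]
    refine ⟨fun h j _ => ?_, fun h j hj => ?_⟩
    · split_ifs with hj
      · simp
      · simp [h j hj]
    · simpa [hj] using h j
  · intro j _
    refine smul_nonneg (stdSimplex.zero_le x j) ?_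
    split_ifs <;> simp

lemma eventually_mem_of_outerWeight_lt {U : Set Y} (hU : IsOpen U) (hBU : B ⊆ U) {m : ℕ}
    {τ : SingularSimplex Y m} (hτ : τ ∈ singleFaceSimplices B m) :
    ∀ᶠ ε in 𝓝[>] (0 : ℝ), ∀ x, outerWeight B τ x < ε → τ x ∈ U := by
  have hK : IsCompact (τ ⁻¹' U)ᶜ := (hU.preimage τ.continuous).isClosed_compl.isCompact
  obtain ⟨a, ha, h⟩ := hK.exists_forall_le' (continuous_outerWeight (B := B) τ).continuousOn
    (a := 0) fun x hx => lt_of_le_of_ne (outerWeight_nonneg τ x) fun h0 =>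
      hx (hBU ((mem_iff_outerWeight_eq_zero hτ x).mpr h0.symm))
  filter_upwards [Ioo_mem_nhdsGT ha] with ε hε x hx
  by_contra hxU
  exact (h x hxU).not_gt (hx.trans hε.2)

/-- Two subdivisions make an admissible chain small with respect to the complement of `B` and a
neighbourhood of `B`. -/
lemma exists_subdivide_subdivide_mem_small {U : Set Y} (hU : IsOpen U) (hBU : B ⊆ U) {m : ℕ}
    {z : SingularChain ℝ Y m} (hz : z ∈ admissibleChains ℝ Y B m) :
    ∃ c : CenterChoice Y, subdivide c m (subdivide (barycentric Y) m z) ∈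
      Finsupp.supported ℝ ℝ (smallSimplices (fun b : Bool => cond b Bᶜ U) m) := by
  set w := subdivide (barycentric Y) m z
  have hw : w ∈ Finsupp.supported ℝ ℝ (singleFaceSimplices B m) := subdivide_barycentric_mem hz
  have hev : ∀ᶠ ε in 𝓝[>] (0 : ℝ), ∀ τ ∈ w.support, ∀ x, outerWeight B τ x < ε → τ x ∈ U :=
    (Filter.eventually_all_finset _).mpr fun τ hτ => eventually_mem_of_outerWeight_lt hU hBU (hw hτ)
  obtain ⟨ε, hε, hε0⟩ := (hev.and self_mem_nhdsWithin).exists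
  refine ⟨separatingCenters B hε0, ?_⟩
  refine map_mem_of_mem_supported _ (fun τ hτ => ?_) ((Finsupp.mem_supported ℝ w).mpr le_rfl)
  refine subdivide_separating_single_mem hε0 fun v hv => ?_
  rcases hv with hv | hv
  · refine ⟨true, ?_⟩
    rintro _ ⟨x, rfl⟩ hx
    have h0 := (mem_iff_outerWeight_eq_zero (hw hτ) _).mp hx
    rw [outerWeight_affineSimplex, Finset.sum_eq_zero_iff_of_nonneg fun i _ =>
      mul_nonneg (stdSimplex.zero_le x i) (outerWeight_nonneg _ _)] at h0
    refine one_ne_zero ((stdSimplex.sum_eq_one x).symm.trans (Finset.sum_eq_zero fun i _ => ?_))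
    exact (mul_eq_zero.mp (h0 i (Finset.mem_univ i))).resolve_right (hv i).ne'
  · refine ⟨false, ?_⟩
    rintro _ ⟨x, rfl⟩
    refine hε τ hτ _ ?_
    rw [outerWeight_affineSimplex]
    exact (convex_Iio ε).sum_mem (fun i _ => x.2.1 i) x.2.2 fun i _ => hv i

end AdmissibleSimplices

/-! ### Collars -/

section Collars

variable {X : Type*} [TopologicalSpace X] {bd : Set X}

/-- A closed collar can be shrunk so that its initial open pieces are open in the ambient space. -/
lemma HasBoundaryCollar.exists_open_collar [CompactSpace X] (hbd : IsClosed bd)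
    (h : HasBoundaryCollar X bd) :
    ∃ φ : C(bd × unitInterval, X), IsClosedEmbedding φ ∧ (∀ x : bd, φ (x, 0) = x) ∧
      (∀ x t, φ (x, t) ∈ bd ↔ t = 0) ∧ ∀ a, IsOpen (φ '' {q | q.2 < a}) := by
  obtain ⟨φ, hφ, hφ0, hnhds, hφbd⟩ := h
  have : CompactSpace bd := isCompact_iff_compactSpace.mp hbd.isCompact
  obtain ⟨V, hV, hbdV, hVφ⟩ := mem_nhdsSet_iff_exists.mp hnhds
  obtain ⟨u, v, -, hv, hu, h0v, huv⟩ := generalized_tube_lemma (isCompact_univ (X := bd))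
    (isCompact_singleton (x := (0 : unitInterval))) (hV.preimage φ.continuous) (by
      rintro ⟨x, t⟩ ⟨-, rfl⟩
      exact hbdV (by rw [hφ0]; exact x.2))
  obtain ⟨b, hb, hbv⟩ := exists_Ico_subset_of_mem_nhds (hv.mem_nhds (h0v rfl)) ⟨1, zero_lt_one⟩
  have hopen (a : unitInterval) (hab : a ≤ b) : IsOpen (φ '' {q | q.2 < a}) := by
    obtain ⟨W, hW, hWa⟩ := hφ.isInducing.isOpen_iff.mp
      (isOpen_lt (continuous_snd (X := bd)) (continuous_const (y := a)))
    have hset : φ '' {q | q.2 < a} = W ∩ V := by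
      refine Set.Subset.antisymm ?_ ?_
      · rintro _ ⟨q, hq, rfl⟩
        refine ⟨?_, huv ⟨hu trivial, hbv ⟨unitInterval.nonneg', lt_of_lt_of_le hq hab⟩⟩⟩
        change q ∈ φ ⁻¹' W
        rw [hWa]
        exact hq
      · rintro y ⟨hyW, hyV⟩
        obtain ⟨q, rfl⟩ := hVφ hyV
        refine ⟨q, ?_, rfl⟩
        rw [← hWa]
        exact hyW
    rw [hset]
    exact hW.inter hV
  let scale : C(unitInterval, unitInterval) := ⟨fun t => b * t, by fun_prop⟩
  have hscale (s t : unitInterval) : scale s < scale t ↔ s < t := by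
    have hb0 : (0 : ℝ) < b := hb
    change (b * s : ℝ) < b * t ↔ (s : ℝ) < t
    exact mul_lt_mul_iff_right₀ hb0
  have hinj : Function.Injective scale :=
    (show StrictMono scale from fun s t => (hscale s t).mpr).injective
  have hscale0 : scale 0 = 0 := mul_zero b
  refine ⟨φ.comp ((ContinuousMap.id _).prodMap scale), ?_, fun x => ?_, fun x t => ?_, fun a => ?_⟩
  · exact hφ.comp (IsClosedEmbedding.id.prodMap
      (scale.continuous.isClosedEmbedding hinj))
  · change φ (x, scale 0) = x
    rw [hscale0, hφ0]
  · change φ (x, scale t) ∈ bd ↔ t = 0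
    rw [hφbd]
    exact ⟨fun ht => hinj (ht.trans hscale0.symm), fun ht => ht ▸ hscale0⟩
  · convert hopen (scale a) unitInterval.mul_le_left using 1
    ext y
    constructor
    · rintro ⟨q, hq, rfl⟩
      exact ⟨(q.1, scale q.2), (hscale _ _).mpr hq, rfl⟩
    · rintro ⟨⟨x, t⟩, hq, rfl⟩
      have hb0 : (0 : ℝ) < b := hb
      have htb : (t : ℝ) ≤ b := le_of_lt (lt_of_lt_of_le (show t < scale a from hq)
        unitInterval.mul_le_left)
      have ht : scale ⟨t / b, div_nonneg t.2.1 hb0.le, (div_le_one hb0).mpr htb⟩ = t :=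
        Subtype.ext (mul_div_cancel₀ _ hb0.ne')
      refine ⟨(x, ⟨t / b, div_nonneg t.2.1 hb0.le, (div_le_one hb0).mpr htb⟩), ?_, ?_⟩
      · refine (hscale _ _).mp ?_
        rw [ht]
        exact hq
      · exact congrArg (fun s => φ (x, s)) ht

/-- A homotopy of the collar coordinate fixing the outer end extends to the whole space. -/
lemma exists_collar_homotopy {φ : C(bd × unitInterval, X)} (hφ : IsClosedEmbedding φ)
    (hopen : IsOpen (φ '' {q | q.2 < 1})) (h : C(unitInterval × unitInterval, unitInterval))
    (h1 : ∀ s, h (1, s) = 1) :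
    ∃ H : C(X × unitInterval, X), (∀ x t s, H (φ (x, t), s) = φ (x, h (t, s))) ∧
      ∀ y ∉ φ '' {q | q.2 < 1}, ∀ s, H (y, s) = y := by
  classical
  let g : X × unitInterval → X := fun p =>
    if hq : ∃ q, φ q = p.1 then φ (hq.choose.1, h (hq.choose.2, p.2)) else p.1
  have hgφ (q : bd × unitInterval) (s : unitInterval) : g (φ q, s) = φ (q.1, h (q.2, s)) := by
    have hq : ∃ q', φ q' = φ q := ⟨q, rfl⟩
    simp only [g, dif_pos hq]
    rw [hφ.injective hq.choose_spec]
  have hgid (y : X) (hy : y ∉ φ '' {q | q.2 < 1}) (s : unitInterval) : g (y, s) = y := by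
    by_cases hq : ∃ q, φ q = y
    · obtain ⟨q, rfl⟩ := hq
      have hq1 : q.2 = 1 := le_antisymm unitInterval.le_one'
        (not_lt.mp fun hlt => hy ⟨q, hlt, rfl⟩)
      rw [hgφ, hq1, h1, ← hq1]
    · simp only [g, dif_neg hq]
  have hcont : Continuous g := by
    refine continuous_iff_isClosed.mpr fun F hF => ?_
    have hset : g ⁻¹' F =
        Prod.map φ id '' {p : (bd × unitInterval) × unitInterval | φ (p.1.1, h (p.1.2, p.2)) ∈ F} ∪
        {p | p.1 ∈ (φ '' {q | q.2 < 1})ᶜ ∩ F} := by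
      ext ⟨y, s⟩
      constructor
      · intro hy
        by_cases hyφ : y ∈ φ '' {q | q.2 < 1}
        · obtain ⟨q, -, rfl⟩ := hyφ
          refine Or.inl ⟨(q, s), ?_, rfl⟩
          rwa [Set.mem_preimage, hgφ] at hy
        · refine Or.inr ⟨hyφ, ?_⟩
          rwa [Set.mem_preimage, hgid y hyφ] at hy
      · rintro (⟨⟨q, s⟩, hq, heq⟩ | ⟨hyφ, hy⟩)
        · rw [← heq, Set.mem_preimage]
          change g (φ q, s) ∈ F
          rw [hgφ]
          exact hq
        · rw [Set.mem_preimage, hgid y hyφ]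
          exact hy
    rw [hset]
    refine IsClosed.union ?_ ?_
    · refine (hφ.prodMap IsClosedEmbedding.id).isClosedMap _ (hF.preimage ?_)
      fun_prop
    · exact (hopen.isClosed_compl.inter hF).preimage continuous_fst
  exact ⟨⟨g, hcont⟩, fun x t s => hgφ (x, t) s, hgid⟩

/-- Deformations of `X` and a neighbourhood of `bd` provided by a collar. -/
structure CollarDeformation (X : Type*) [TopologicalSpace X] (bd : Set X) where
  /-- an open neighbourhood of `bd` -/
  nbhd : Set X
  isOpen_nbhd : IsOpen nbhd
  bd_subset : bd ⊆ nbhd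
  /-- a homotopy pushing the neighbourhood into `bd` -/
  shrink : C(X × unitInterval, X)
  shrink_zero : ∀ y, shrink (y, 0) = y
  shrink_one_mem : ∀ y ∈ nbhd, shrink (y, 1) ∈ bd
  shrink_mem : ∀ y ∈ bd, ∀ s, shrink (y, s) ∈ bd
  /-- a homotopy pushing the whole space off `bd` -/
  inflate : C(X × unitInterval, X)
  inflate_zero : ∀ y, inflate (y, 0) = y
  inflate_mem : ∀ y ∈ nbhd, ∀ s, inflate (y, s) ∈ nbhd
  inflate_one_notMem : ∀ y, inflate (y, 1) ∉ bd
  inflate_mem_bd_iff : ∀ y ∈ bd, ∀ s, inflate (y, s) ∈ bd ↔ s = 0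

lemma HasBoundaryCollar.nonempty_collarDeformation [CompactSpace X] (hbd : IsClosed bd)
    (h : HasBoundaryCollar X bd) : Nonempty (CollarDeformation X bd) := by
  obtain ⟨φ, hφ, hφ0, hφbd, hopen⟩ := h.exists_open_collar hbd
  let f : C(unitInterval × unitInterval, unitInterval) :=
    ⟨fun p => ⟨max 0 (p.1 - p.2 * (1 - p.1)), le_max_left _ _, max_le zero_le_one (by
      nlinarith [p.1.2.1, p.1.2.2, p.2.2.1, p.2.2.2])⟩, by fun_prop⟩
  let g : C(unitInterval × unitInterval, unitInterval) :=
    ⟨fun p => ⟨max p.1 (p.2 / 4), le_max_of_le_left p.1.2.1, max_le p.1.2.2 (by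
      linarith [p.2.2.2])⟩, by fun_prop⟩
  have hf (t s : unitInterval) : (f (t, s) : ℝ) = max 0 (t - s * (1 - t) : ℝ) := rfl
  have hg (t s : unitInterval) : (g (t, s) : ℝ) = max (t : ℝ) (s / 4) := rfl
  obtain ⟨F, hF, hF'⟩ := exists_collar_homotopy hφ (hopen 1) f fun s => Subtype.ext (by simp [hf])
  obtain ⟨G, hG, hG'⟩ := exists_collar_homotopy hφ (hopen 1) g fun s => Subtype.ext (by
    rw [hg]
    exact max_eq_left (by linarith [s.2.2, (Set.Icc.coe_one : ((1 : unitInterval) : ℝ) = 1)]))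
  let half : unitInterval := ⟨1 / 2, by norm_num, by norm_num⟩
  have cases (P : X → Prop) (h1 : ∀ x t, P (φ (x, t))) (h2 : ∀ y ∉ φ '' {q | q.2 < 1}, P y)
      (y : X) : P y := by
    by_cases hy : y ∈ φ '' {q | q.2 < 1}
    · obtain ⟨q, -, rfl⟩ := hy
      exact h1 q.1 q.2
    · exact h2 y hy
  have hbd_mem (y : X) (hy : y ∈ bd) (a : unitInterval) (ha : 0 < a) :
      y ∈ φ '' {q | q.2 < a} := ⟨(⟨y, hy⟩, 0), ha, hφ0 _⟩
  have hF_bd (x : bd) (s : unitInterval) : F (x, s) = φ (x, f (0, s)) := by rw [← hF, hφ0]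
  have hG_bd (x : bd) (s : unitInterval) : G (x, s) = φ (x, g (0, s)) := by rw [← hG, hφ0]
  refine ⟨⟨φ '' {q | q.2 < half}, hopen half, fun y hy => hbd_mem y hy half ?_, F, ?_, ?_, ?_,
    G, ?_, ?_, ?_, ?_⟩⟩
  · exact Subtype.mk_lt_mk.mpr (by norm_num)
  · refine cases _ (fun x t => ?_) fun y hy => hF' y hy 0
    rw [hF, show f (t, 0) = t from Subtype.ext (by simp [hf, t.2.1])]
  · rintro _ ⟨⟨x, t⟩, ht, rfl⟩
    have ht' : (t : ℝ) < 1 / 2 := ht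
    rw [hF, hφbd]
    refine Subtype.ext ?_
    rw [hf]
    exact max_eq_left (by rw [Set.Icc.coe_one]; linarith)
  · intro y hy s
    rw [hF_bd ⟨y, hy⟩, hφbd]
    refine Subtype.ext ?_
    rw [hf]
    exact max_eq_left (by rw [Set.Icc.coe_zero]; linarith [s.2.1])
  · refine cases _ (fun x t => ?_) fun y hy => hG' y hy 0
    rw [hG, show g (t, 0) = t from Subtype.ext (by simp [hg, t.2.1])]
  · rintro _ ⟨⟨x, t⟩, ht, rfl⟩ s
    have ht' : (t : ℝ) < 1 / 2 := ht
    rw [hG]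
    refine ⟨_, ?_, rfl⟩
    change max (t : ℝ) (s / 4) < 1 / 2
    exact max_lt ht' (by linarith [s.2.2])
  · refine cases _ (fun x t => ?_) fun y hy => ?_
    · rw [hG, hφbd]
      intro h0
      have h1 := hg t 1
      rw [h0, Set.Icc.coe_one, Set.Icc.coe_zero] at h1
      linarith [le_max_right (t : ℝ) (1 / 4)]
    · rw [hG' y hy]
      exact fun hyb => hy (hbd_mem y hyb 1 zero_lt_one)
  · intro y hy s
    rw [hG_bd ⟨y, hy⟩, hφbd]
    refine ⟨fun h0 => Subtype.ext ?_, ?_⟩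
    · have h1 := hg 0 s
      rw [h0, Set.Icc.coe_zero] at h1
      have := le_max_right (0 : ℝ) (s / 4)
      rw [Set.Icc.coe_zero]
      linarith [s.2.1]
    · rintro rfl
      exact Subtype.ext (by simp [hg])

end Collars

/-! ### The collapsed space -/

section Collapse

variable {X : Type*} [TopologicalSpace X] {bd : Set X}

lemma collapseMap_mem_image_iff {V : Set X} (hV : bd ⊆ V ∨ Disjoint V bd) {y : X} :
    collapseMap X bd y ∈ collapseMap X bd '' V ↔ y ∈ V := by
  refine ⟨?_, Set.mem_image_of_mem _⟩
  rintro ⟨y', hy', h⟩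
  have hrel : ∀ a b, collapseRel X bd a b → (a ∈ V) = (b ∈ V) := by
    rintro a b (rfl | ⟨ha, hb, -⟩)
    · rfl
    · rcases hV with hV | hV
      · exact propext ⟨fun _ => hV hb, fun _ => hV ha⟩
      · exact propext ⟨fun h => absurd ha (hV.notMem_of_mem_left h),
          fun h => absurd hb (hV.notMem_of_mem_left h)⟩
  have := congrArg (Quot.lift (· ∈ V) hrel) h
  exact this.mp hy'

lemma collapseMap_mem_collapsedBoundary {y : X} :
    collapseMap X bd y ∈ collapsedBoundary X bd ↔ y ∈ bd :=
  collapseMap_mem_image_iff (Or.inl le_rfl)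

lemma isOpen_collapseMap_image {V : Set X} (hV : bd ⊆ V ∨ Disjoint V bd) (ho : IsOpen V) :
    IsOpen (collapseMap X bd '' V) := by
  refine (isQuotientMap_quot_mk (r := collapseRel X bd)).isOpen_preimage.mp ?_
  convert ho using 1
  ext y
  exact collapseMap_mem_image_iff hV

lemma collapseMap_injOn : Set.InjOn (collapseMap X bd) bdᶜ := by
  intro a _ b hb h
  have h1 : collapseMap X bd a ∈ collapseMap X bd '' {b} := ⟨b, rfl, h.symm⟩
  exact (collapseMap_mem_image_iff (Or.inr (Set.disjoint_singleton_left.mpr hb))).mp h1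

lemma isOpen_compl_collapsedBoundary (hbd : IsClosed bd) : IsOpen (collapsedBoundary X bd)ᶜ := by
  refine (isQuotientMap_quot_mk (r := collapseRel X bd)).isOpen_preimage.mp ?_
  convert hbd.isOpen_compl using 1
  ext y
  exact not_congr collapseMap_mem_collapsedBoundary

lemma isOpenEmbedding_collapseMap_restrict (hbd : IsClosed bd) :
    IsOpenEmbedding fun y : ↥bdᶜ => collapseMap X bd y := by
  refine IsOpenEmbedding.of_continuous_injective_isOpenMap (by fun_prop)
    (fun a b h => Subtype.ext (collapseMap_injOn a.2 b.2 h)) fun W hW => ?_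
  have h1 : IsOpen (Subtype.val '' W) := hbd.isOpen_compl.isOpenMap_subtype_val W hW
  have h2 := isOpen_collapseMap_image (bd := bd) (Or.inr ?_) h1
  · rwa [Set.image_image] at h2
  · rw [Set.disjoint_left]
    rintro _ ⟨y, -, rfl⟩
    exact y.2

lemma exists_lift_simplex (hbd : IsClosed bd) {m : ℕ} {τ : SingularSimplex (Collapse X bd) m}
    (hτ : Set.range τ ⊆ (collapsedBoundary X bd)ᶜ) :
    ∃ σ : SingularSimplex X m, (collapseMap X bd).comp σ = τ ∧ Set.range σ ⊆ bdᶜ := by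
  have hex (x : TopSimplex m) : ∃ y : ↥bdᶜ, collapseMap X bd y = τ x := by
    obtain ⟨y, hy⟩ := Quot.exists_rep (τ x)
    refine ⟨⟨y, fun hyb => hτ ⟨x, rfl⟩ ?_⟩, hy⟩
    rw [← hy]
    exact collapseMap_mem_collapsedBoundary.mpr hyb
  choose f hf using hex
  have hcont : Continuous f := by
    rw [(isOpenEmbedding_collapseMap_restrict hbd).isInducing.continuous_iff]
    exact τ.continuous.congr fun x => (hf x).symm
  refine ⟨⟨fun x => f x, continuous_subtype_val.comp hcont⟩, ContinuousMap.ext hf, ?_⟩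
  rintro _ ⟨x, rfl⟩
  exact (f x).2

/-- Chains avoiding the marked points lift isometrically. -/
lemma exists_lift_chain (hbd : IsClosed bd) {m : ℕ} {c : SingularChain ℝ (Collapse X bd) m}
    (hc : c ∈ chainsIn ℝ _ (collapsedBoundary X bd)ᶜ m) :
    ∃ c' ∈ chainsIn ℝ X bdᶜ m, pushChain ℝ (collapseMap X bd) m c' = c ∧ ellOne c' ≤ ellOne c := by
  classical
  let T : SingularChain ℝ (Collapse X bd) m →ₗ[ℝ] SingularChain ℝ X m :=
    Finsupp.linearCombination ℝ fun τ =>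
      if h : Set.range τ ⊆ (collapsedBoundary X bd)ᶜ then
        Finsupp.single (exists_lift_simplex hbd h).choose 1 else 0
  have hT (τ : SingularSimplex (Collapse X bd) m)
      (h : Set.range τ ⊆ (collapsedBoundary X bd)ᶜ) :
      T (Finsupp.single τ 1) = Finsupp.single (exists_lift_simplex hbd h).choose 1 := by
    simp [T, h]
  rw [chainsIn_eq_supported] at hc
  refine ⟨T c, map_mem_of_mem_supported T (fun τ hτ => ?_) hc, ?_, ?_⟩
  · rw [hT τ hτ]
    exact single_mem_chainsIn (exists_lift_simplex hbd hτ).choose_spec.2 1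
  · have h0 : ((pushChain ℝ (collapseMap X bd) m).comp T -
        (LinearMap.id : SingularChain ℝ (Collapse X bd) m →ₗ[ℝ] _)) c ∈
        (⊥ : Submodule ℝ (SingularChain ℝ (Collapse X bd) m)) := by
      refine map_mem_of_mem_supported _ (fun τ hτ => ?_) hc
      rw [LinearMap.sub_apply, LinearMap.comp_apply, hT τ hτ, pushChain_single,
        (exists_lift_simplex hbd hτ).choose_spec.1, LinearMap.id_apply, sub_self]
      exact zero_mem _
    exact sub_eq_zero.mp h0
  · refine (ellOne_map_le T 1 c fun τ => ?_).trans_eq (one_mul _)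
    by_cases h : Set.range τ ⊆ (collapsedBoundary X bd)ᶜ
    · rw [hT τ h, ellOne_single, abs_one]
    · simp [T, h, ellOne]

lemma mem_chainsIn_of_pushChain_collapseMap {V : Set X} (hV : bd ⊆ V) {m : ℕ}
    {w : SingularChain ℝ X m} (hw : w ∈ chainsIn ℝ X bdᶜ m)
    (h : pushChain ℝ (collapseMap X bd) m w ∈ chainsIn ℝ _ (collapseMap X bd '' V) m) :
    w ∈ chainsIn ℝ X V m := by
  rw [chainsIn_eq_supported] at hw h ⊢
  have hinj : Set.InjOn (fun σ : SingularSimplex X m => (collapseMap X bd).comp σ)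
      {σ | Set.range σ ⊆ bdᶜ} := fun σ hσ τ hτ hστ => ContinuousMap.ext fun x =>
    collapseMap_injOn (hσ ⟨x, rfl⟩) (hτ ⟨x, rfl⟩) (DFunLike.congr_fun hστ x)
  intro σ hσ
  have h1 : (collapseMap X bd).comp σ ∈ (pushChain ℝ (collapseMap X bd) m w).support := by
    rw [Finsupp.mem_support_iff, pushChain, Finsupp.lmapDomain_apply,
      Finsupp.mapDomain_apply' _ _ hw hinj (hw hσ)]
    exact Finsupp.mem_support_iff.mp hσ
  rintro _ ⟨x, rfl⟩
  exact (collapseMap_mem_image_iff (Or.inl hV)).mp (h h1 ⟨x, rfl⟩)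

end Collapse

/-! ### Comparison of the two volumes -/

section Comparison

variable {X : Type*} [TopologicalSpace X] {bd : Set X}

lemma homotopyAt_zero_eq_id {H : C(X × unitInterval, X)} (h : ∀ y, H (y, 0) = y) :
    homotopyAt H 0 = ContinuousMap.id X :=
  ContinuousMap.ext h

lemma relativeBoundaries_mono {A B : Set X} (h : A ⊆ B) (n : ℕ) :
    relativeBoundaries ℝ X A n ≤ relativeBoundaries ℝ X B n :=
  sup_le_sup_left (chainsIn_mono h n) _

/-- Excision: a chain off `bd` bounding after the collapse bounds relative to a neighbourhood. -/
lemma mem_relativeBoundaries_of_pushChain_collapseMap (hbd : IsClosed bd) {O : Set X}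
    (hO : IsOpen O) (hbdO : bd ⊆ O) {n : ℕ} {y : SingularChain ℝ X n}
    (hy : y ∈ chainsIn ℝ X bdᶜ n)
    (h : pushChain ℝ (collapseMap X bd) n y ∈
      relativeBoundaries ℝ _ (collapseMap X bd '' O) n) :
    y ∈ relativeBoundaries ℝ X O n := by
  have hpy : pushChain ℝ (collapseMap X bd) n y ∈ chainsIn ℝ _ (collapsedBoundary X bd)ᶜ n :=
    pushChain_mem_chainsIn _ (fun x hx => mt collapseMap_mem_collapsedBoundary.mp hx) hy
  have hsmall : pushChain ℝ (collapseMap X bd) n y ∈ Finsupp.supported ℝ ℝ (smallSimplices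
      (fun b : Bool => cond b (collapsedBoundary X bd)ᶜ (collapseMap X bd '' O)) n) := by
    rw [chainsIn_eq_supported] at hpy
    exact fun τ hτ => ⟨true, hpy hτ⟩
  obtain ⟨e, he, hye⟩ := exists_small_bounding
    (c := fun b : Bool => cond b (collapsedBoundary X bd)ᶜ (collapseMap X bd '' O))
    (Bool.forall_bool.mpr ⟨isOpen_collapseMap_image (Or.inl hbdO) hO,
      isOpen_compl_collapsedBoundary hbd⟩)
    (by
      refine Set.eq_univ_of_forall fun q => Set.mem_iUnion.mpr ?_
      by_cases hq : q ∈ collapsedBoundary X bd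
      · exact ⟨false, Set.image_mono hbdO hq⟩
      · exact ⟨true, hq⟩)
    hsmall h
  obtain ⟨a, ha, hea, -⟩ := exists_split_of_small he
  obtain ⟨a, ha', rfl, -⟩ := exists_lift_chain hbd ha
  refine mem_relativeBoundaries_iff.mpr ⟨a, mem_chainsIn_of_pushChain_collapseMap hbdO
    (sub_mem hy (boundary_mem_chainsIn ha')) ?_⟩
  have := add_mem hye (boundary_mem_chainsIn hea)
  rwa [map_sub, sub_add_sub_cancel, boundary_pushChain, ← map_sub] at this

lemma mem_admissibleChains_of_mem_markedCycles {B : Set X} {n : ℕ} {z : SingularChain ℝ X n}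
    (hz : z ∈ markedCycles ℝ X B n) : z ∈ admissibleChains ℝ X B n := by
  cases n with
  | zero => exact hz
  | succ n => exact hz.1

lemma mem_relativeCycles_of_mem_markedCycles {B : Set X} {n : ℕ} {z : SingularChain ℝ X n}
    (hz : z ∈ markedCycles ℝ X B n) : z ∈ relativeCycles ℝ X B n := by
  cases n with
  | zero => trivial
  | succ n => exact hz.2

/-- An ideal representative yields a relative representative with controlled norm. -/
lemma exists_relative_of_idealRepresents (hbd : IsClosed bd) (D : CollarDeformation X bd) {n : ℕ}
    {ζ : SingularChain ℝ X n} (hζ : ζ ∈ relativeCycles ℝ X bd n)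
    {z : SingularChain ℝ (Collapse X bd) n} (hz : IdealRepresents X bd n ζ z) :
    ∃ w ∈ relativeCycles ℝ X bd n, w - ζ ∈ relativeBoundaries ℝ X bd n ∧
      ellOne w ≤ ((n + 1).factorial : ℝ) ^ 2 * ellOne z := by
  set p := collapseMap X bd
  set U := p '' D.nbhd
  have hU : IsOpen U := isOpen_collapseMap_image (Or.inl D.bd_subset) D.isOpen_nbhd
  have hBU : collapsedBoundary X bd ⊆ U := Set.image_mono D.bd_subset
  obtain ⟨hzM, hzζ⟩ := hz
  obtain ⟨c, hsmall⟩ := exists_subdivide_subdivide_mem_small hU hBU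
    (mem_admissibleChains_of_mem_markedCycles hzM)
  set z' := subdivide (barycentric _) n z
  set z'' := subdivide c n z'
  have hzcyc := mem_relativeCycles_of_mem_markedCycles hzM
  have hz' : z' - z ∈ relativeBoundaries ℝ _ (collapsedBoundary X bd) n :=
    subdivide_sub_mem _ hzcyc
  have hz'cyc : z' ∈ relativeCycles ℝ _ (collapsedBoundary X bd) n := by
    simpa using add_mem (relativeBoundaries_le_relativeCycles _ _ hz') hzcyc
  have hz'' : z'' - pushChain ℝ p n ζ ∈ relativeBoundaries ℝ _ U n := by
    have := add_mem (add_mem (subdivide_sub_mem c hz'cyc) hz') hzζ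
    rw [sub_add_sub_cancel, sub_add_sub_cancel] at this
    exact relativeBoundaries_mono hBU n this
  obtain ⟨a, ha, hza, hanorm⟩ := exists_split_of_small hsmall
  obtain ⟨y, hy, rfl, hynorm⟩ := exists_lift_chain hbd ha
  have hinflate : pushChain ℝ (homotopyAt D.inflate 1) n ζ - ζ ∈
      relativeBoundaries ℝ X D.nbhd n := by
    have := pushChain_homotopy_sub_mem D.inflate D.inflate_mem
      (relativeCycles_mono D.bd_subset n hζ)
    rwa [homotopyAt_zero_eq_id D.inflate_zero, pushChain_id] at this
  have hyζ : y - pushChain ℝ (homotopyAt D.inflate 1) n ζ ∈ relativeBoundaries ℝ X D.nbhd n := by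
    refine mem_relativeBoundaries_of_pushChain_collapseMap hbd D.isOpen_nbhd D.bd_subset
      (sub_mem hy ?_) ?_
    · refine pushChain_mem_chainsIn (A := Set.univ) _ (fun x _ => D.inflate_one_notMem x) ?_
      rw [chainsIn_eq_supported]
      exact fun σ _ => Set.subset_univ _
    · have h1 := pushChain_mem_relativeBoundaries p (B := U)
        (fun x hx => Set.mem_image_of_mem p hx) hinflate
      have := sub_mem (sub_mem hz'' (mem_relativeBoundaries_of_mem_chainsIn hza)) h1
      convert this using 1
      rw [map_sub, map_sub]
      abel
  have hyζ' : y - ζ ∈ relativeBoundaries ℝ X D.nbhd n := by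
    simpa using add_mem hyζ hinflate
  have hshrink : pushChain ℝ (homotopyAt D.shrink 1) n ζ - ζ ∈ relativeBoundaries ℝ X bd n := by
    have := pushChain_homotopy_sub_mem D.shrink D.shrink_mem hζ
    rwa [homotopyAt_zero_eq_id D.shrink_zero, pushChain_id] at this
  have hw : pushChain ℝ (homotopyAt D.shrink 1) n y - ζ ∈ relativeBoundaries ℝ X bd n := by
    have := add_mem (pushChain_mem_relativeBoundaries (homotopyAt D.shrink 1) (B := bd)
      D.shrink_one_mem hyζ') hshrink
    rwa [map_sub, sub_add_sub_cancel] at this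
  refine ⟨_, ?_, hw, ?_⟩
  · simpa using add_mem (relativeBoundaries_le_relativeCycles _ _ hw) hζ
  · calc ellOne (pushChain ℝ (homotopyAt D.shrink 1) n y) ≤ ellOne y := ellOne_mapDomain_le _ _
      _ ≤ ellOne z'' := hynorm.trans hanorm
      _ ≤ (n + 1).factorial * ellOne z' := ellOne_subdivide_le c z'
      _ ≤ (n + 1).factorial * ((n + 1).factorial * ellOne z) := by
        gcongr
        exact ellOne_subdivide_le _ z
      _ = ((n + 1).factorial : ℝ) ^ 2 * ellOne z := by ring

lemma admissible_of_range_subset_compl {B : Set X} {n : ℕ} {τ : SingularSimplex X n}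
    (h : Set.range τ ⊆ Bᶜ) : Admissible B τ := by
  refine ⟨∅, ?_⟩
  simp only [Set.mem_empty_iff_false, Set.iUnion_of_empty, Set.iUnion_empty]
  exact Set.eq_empty_of_forall_notMem fun x hx => h ⟨x, rfl⟩ hx

lemma CollarDeformation.admissible_inflate (D : CollarDeformation X bd) {m k : ℕ}
    {σ : SingularSimplex X m} (hσ : Set.range σ ⊆ bd) (v : Fin (k + 1) → Prism m) :
    Admissible bd ((prismMap D.inflate σ).comp (affinePrism v)) := by
  classical
  refine ⟨{Finset.univ.filter fun i => (v i).2 = 0}, ?_⟩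
  rw [Set.biUnion_singleton]
  ext x
  refine (D.inflate_mem_bd_iff _ (hσ ⟨_, rfl⟩) _).trans ?_
  rw [Subtype.ext_iff]
  change ∑ i, x i * ((v i).2 : ℝ) = 0 ↔ _
  refine (Finset.sum_eq_zero_iff_of_nonneg fun i _ =>
    mul_nonneg (stdSimplex.zero_le x i) (v i).2.2.1).trans ?_
  refine ⟨fun h i hi => ?_, fun h i _ => ?_⟩
  · refine (mul_eq_zero.mp (h i (Finset.mem_univ i))).resolve_right fun h0 => hi ?_
    exact Finset.mem_filter.mpr ⟨Finset.mem_univ i, Subtype.ext h0⟩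
  · by_cases hi : (v i).2 = 0
    · exact mul_eq_zero_of_right _ (congrArg Subtype.val hi)
    · refine mul_eq_zero_of_left (h i fun hmem => hi (Finset.mem_filter.mp hmem).2) _

lemma ellOne_boundary_le {n : ℕ} (c : SingularChain ℝ X (n + 1)) :
    ellOne (boundary ℝ X n c) ≤ (n + 2) * ellOne c := by
  refine ellOne_map_le _ _ c fun σ => ?_
  rw [boundary_single, one_smul, boundaryOf]
  refine (ellOne_sum_le _ _).trans_eq ?_
  simp [ellOne_single]

/-- Relative cycles can be replaced by admissible ones with controlled norm. -/
lemma CollarDeformation.exists_admissible_representative (D : CollarDeformation X bd) (n : ℕ) :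
    ∃ K : ℝ, ∀ w ∈ relativeCycles ℝ X bd n, ∃ z ∈ admissibleChains ℝ X bd n,
      z - w ∈ relativeBoundaries ℝ X bd n ∧ ellOne z ≤ K * ellOne w := by
  have hoff (u : SingularChain ℝ X n) :
      pushChain ℝ (homotopyAt D.inflate 1) n u ∈ admissibleChains ℝ X bd n := by
    rw [admissibleChains_eq_supported]
    refine map_mem_of_mem_supported _ (s := Set.univ) (fun σ _ => ?_) (by simp)
    rw [pushChain_single]
    refine Finsupp.single_mem_supported ℝ _ (admissible_of_range_subset_compl ?_)
    rintro _ ⟨x, rfl⟩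
    exact D.inflate_one_notMem _
  have hnorm (w : SingularChain ℝ X n) : ellOne (pushChain ℝ (homotopyAt D.inflate 1) n
      (subdivide (barycentric X) n w)) ≤ (n + 1).factorial * ellOne w :=
    (ellOne_mapDomain_le _ _).trans (ellOne_subdivide_le _ w)
  cases n with
  | zero =>
    refine ⟨(0 + 1).factorial, fun w _ => ⟨_, hoff (subdivide (barycentric X) 0 w), ?_, hnorm w⟩⟩
    have := boundary_modelOp_homotopyModel_zero D.inflate (barycentric X) w
    rw [homotopyAt_zero_eq_id D.inflate_zero, pushChain_id] at this
    rw [← this]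
    exact boundary_mem_relativeBoundaries _ _
  | succ n =>
    obtain ⟨K, hK⟩ := exists_ellOne_homotopyModel_le (barycentric X) n
    refine ⟨(n + 1 + 1).factorial + |K| * (n + 2), fun w hw => ⟨_, sub_mem
      (hoff (subdivide (barycentric X) (n + 1) w)) (?_ : modelOp D.inflate
        (homotopyModel (barycentric X) n) (boundary ℝ X n w) ∈ _), ?_, ?_⟩⟩
    · have hw' : boundary ℝ X n w ∈ chainsIn ℝ X bd n := hw
      rw [chainsIn_eq_supported] at hw'
      rw [admissibleChains_eq_supported]
      refine map_mem_of_mem_supported _ (fun σ hσ => ?_) hw'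
      exact modelOp_single_mem _ (s := Set.univ) (by simp) fun v _ => D.admissible_inflate hσ v
    · have := boundary_modelOp_homotopyModel_succ D.inflate (barycentric X) w
      rw [homotopyAt_zero_eq_id D.inflate_zero, pushChain_id, sub_right_comm] at this
      rw [← this]
      exact boundary_mem_relativeBoundaries _ _
    · refine (ellOne_sub_le _ _).trans ?_
      rw [add_mul, mul_assoc]
      refine add_le_add (hnorm w) ((ellOne_modelOp_le _ (fun σ => (hK σ).trans (le_abs_self K))
        _).trans ?_)
      exact mul_le_mul_of_nonneg_left (ellOne_boundary_le w) (abs_nonneg K)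

lemma pushChain_collapseMap_mem_admissibleChains {n : ℕ} {z : SingularChain ℝ X n}
    (hz : z ∈ admissibleChains ℝ X bd n) :
    pushChain ℝ (collapseMap X bd) n z ∈
      admissibleChains ℝ (Collapse X bd) (collapsedBoundary X bd) n := by
  rw [admissibleChains_eq_supported] at hz ⊢
  refine map_mem_of_mem_supported _ (fun σ hσ => ?_) hz
  rw [pushChain_single]
  refine Finsupp.single_mem_supported ℝ _ ?_
  obtain ⟨𝒮, h𝒮⟩ := hσ
  refine ⟨𝒮, h𝒮 ▸ ?_⟩
  ext x
  exact collapseMap_mem_collapsedBoundary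

/-- A relative representative yields an ideal representative with controlled norm. -/
lemma CollarDeformation.exists_idealRepresents (D : CollarDeformation X bd) (n : ℕ) :
    ∃ K : ℝ, ∀ ζ w : SingularChain ℝ X n, w ∈ relativeCycles ℝ X bd n →
      w - ζ ∈ relativeBoundaries ℝ X bd n →
      ∃ z, IdealRepresents X bd n ζ z ∧ ellOne z ≤ K * ellOne w := by
  obtain ⟨K, hK⟩ := D.exists_admissible_representative n
  refine ⟨K, fun ζ w hw hwζ => ?_⟩
  obtain ⟨z, hz, hzw, hnorm⟩ := hK w hw
  have hmaps : ∀ x ∈ bd, collapseMap X bd x ∈ collapsedBoundary X bd :=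
    fun x hx => Set.mem_image_of_mem _ hx
  have hzcyc : z ∈ relativeCycles ℝ X bd n := by
    simpa using add_mem (relativeBoundaries_le_relativeCycles _ _ hzw) hw
  refine ⟨pushChain ℝ (collapseMap X bd) n z, ⟨?_, ?_⟩, (ellOne_mapDomain_le _ _).trans hnorm⟩
  · cases n with
    | zero => exact pushChain_collapseMap_mem_admissibleChains hz
    | succ n =>
      refine ⟨pushChain_collapseMap_mem_admissibleChains hz, ?_⟩
      change boundary ℝ (Collapse X bd) n (pushChain ℝ (collapseMap X bd) (n + 1) z) ∈
        chainsIn ℝ (Collapse X bd) (collapsedBoundary X bd) n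
      rw [boundary_pushChain]
      exact pushChain_mem_chainsIn _ hmaps hzcyc
  · rw [idealFundamentalRep, ← map_sub]
    refine pushChain_mem_relativeBoundaries _ hmaps ?_
    simpa using add_mem hzw hwζ

lemma simplicialVolume_nonneg (n : ℕ) (ζ : SingularChain ℝ X n) :
    0 ≤ simplicialVolume X bd n ζ := by
  refine Real.sInf_nonneg ?_
  rintro _ ⟨z, -, -, rfl⟩
  exact ellOne_nonneg z

lemma idealSimplicialVolume_nonneg (n : ℕ) (ζ : SingularChain ℝ X n) :
    0 ≤ idealSimplicialVolume X bd n ζ := by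
  refine Real.sInf_nonneg ?_
  rintro _ ⟨z, -, rfl⟩
  exact ellOne_nonneg z

lemma simplicialVolume_le {n : ℕ} {ζ w : SingularChain ℝ X n} (hw : w ∈ relativeCycles ℝ X bd n)
    (hwζ : w - ζ ∈ relativeBoundaries ℝ X bd n) : simplicialVolume X bd n ζ ≤ ellOne w := by
  refine csInf_le ⟨0, ?_⟩ ⟨w, hw, hwζ, rfl⟩
  rintro _ ⟨z, -, -, rfl⟩
  exact ellOne_nonneg z

lemma idealSimplicialVolume_le {n : ℕ} {ζ : SingularChain ℝ X n}
    {z : SingularChain ℝ (Collapse X bd) n} (hz : IdealRepresents X bd n ζ z) :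
    idealSimplicialVolume X bd n ζ ≤ ellOne z := by
  refine csInf_le ⟨0, ?_⟩ ⟨z, hz, rfl⟩
  rintro _ ⟨z, -, rfl⟩
  exact ellOne_nonneg z

lemma IsCptMfdBdry.nonempty_collarDeformation {n : ℕ} {ζ : SingularChain ℝ X n}
    (h : IsCptMfdBdry X bd n ζ) : Nonempty (CollarDeformation X bd) :=
  have := h.compact
  h.collar.nonempty_collarDeformation h.bd_closed

lemma IsCptMfdBdry.simplicialVolume_le_mul {n : ℕ} {ζ : SingularChain ℝ X n}
    (h : IsCptMfdBdry X bd n ζ) : simplicialVolume X bd n ζ ≤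
      ((n + 1).factorial : ℝ) ^ 2 * idealSimplicialVolume X bd n ζ := by
  obtain ⟨D⟩ := h.nonempty_collarDeformation
  have hpos : (0 : ℝ) < ((n + 1).factorial : ℝ) ^ 2 := by positivity
  rw [← div_le_iff₀' hpos]
  refine le_csInf ?_ ?_
  · obtain ⟨K, hK⟩ := D.exists_idealRepresents n
    obtain ⟨z, hz, -⟩ := hK ζ ζ h.fund.1 (by rw [sub_self]; exact zero_mem _)
    exact ⟨_, z, hz, rfl⟩
  · rintro _ ⟨z, hz, rfl⟩
    obtain ⟨w, hw, hwζ, hnorm⟩ := exists_relative_of_idealRepresents h.bd_closed D h.fund.1 hz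
    rw [div_le_iff₀' hpos]
    exact (simplicialVolume_le hw hwζ).trans hnorm

lemma IsCptMfdBdry.exists_idealSimplicialVolume_le_mul {n : ℕ} {ζ : SingularChain ℝ X n}
    (h : IsCptMfdBdry X bd n ζ) :
    ∃ K : ℝ, idealSimplicialVolume X bd n ζ ≤ K * simplicialVolume X bd n ζ := by
  obtain ⟨D⟩ := h.nonempty_collarDeformation
  obtain ⟨K, hK⟩ := D.exists_idealRepresents n
  have hpos : 0 < |K| + 1 := by positivity
  refine ⟨|K| + 1, ?_⟩
  rw [← div_le_iff₀' hpos]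
  refine le_csInf ⟨_, ζ, h.fund.1, by rw [sub_self]; exact zero_mem _, rfl⟩ ?_
  rintro _ ⟨w, hw, hwζ, rfl⟩
  obtain ⟨z, hz, hnorm⟩ := hK ζ w hw hwζ
  rw [div_le_iff₀' hpos]
  refine (idealSimplicialVolume_le hz).trans (hnorm.trans ?_)
  exact mul_le_mul_of_nonneg_right ((le_abs_self K).trans (by linarith)) (ellOne_nonneg w)

end Comparison

/-- **Theorem C.** For every `n` there is a constant `K_n > 0` such that every compact
connected oriented `n`-manifold `M` with boundary satisfies `‖M‖ ≤ K_n ⬝ ‖M‖_I`.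
In particular (combined with `‖M‖_I ≤ ‖M‖`), `‖M‖_I = 0` if and only if `‖M‖ = 0`. -/
theorem simplicialVolume_le_const_mul_idealSimplicialVolume (n : ℕ) :
    (∃ K : ℝ, 0 < K ∧
      ∀ (X : Type) (_ : TopologicalSpace X) (bd : Set X) (ζ : SingularChain ℝ X n),
        IsCptMfdBdry X bd n ζ →
          simplicialVolume X bd n ζ ≤ K * idealSimplicialVolume X bd n ζ) ∧
    ∀ (X : Type) (_ : TopologicalSpace X) (bd : Set X) (ζ : SingularChain ℝ X n),
      IsCptMfdBdry X bd n ζ →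
        (idealSimplicialVolume X bd n ζ = 0 ↔ simplicialVolume X bd n ζ = 0) := by
  refine ⟨⟨((n + 1).factorial : ℝ) ^ 2, by positivity, fun X _ bd ζ h =>
    h.simplicialVolume_le_mul⟩, fun X _ bd ζ h => ⟨fun h0 => ?_, fun h0 => ?_⟩⟩
  · refine le_antisymm ?_ (simplicialVolume_nonneg n ζ)
    simpa [h0] using h.simplicialVolume_le_mul
  · obtain ⟨K, hK⟩ := h.exists_idealSimplicialVolume_le_mul
    refine le_antisymm ?_ (idealSimplicialVolume_nonneg n ζ)
    simpa [h0] using hK
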